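/- Let q be a prime with q ≡ 1 (mod 4) and define M_{2g} = q^{2g+1}(1 − 1/q) Σ_{f ∈ M_{≤2g}, f a square} (d_2(f) φ(f)/|f|^{3/2}) Σ_{C ∈ M_{≤g−1}, C | f^∞} |C|^{−2}, and M_{2g−1} the same expression with M_{≤2g} replaced by M_{≤2g−1}. Then for every ε > 0 and every 0 < r_1 < 1/q, M_{2g} = (q^{2g+1}/ζ(2)) · (1/2πi) ∮_{|u|=r_1} (1 − qu^2) B(u) / ((1 − qu)^4 (qu)^g) · du/u + O_ε(q^{gε}), and M_{2g−1} equals the same integral with (qu)^g replaced by (qu)^{g−1}, up to O_ε(q^{gε}), where B(u) = ∏_P ( 1 + u^{d(P)}(u^{d(P)} − 3)/((|P|+1)(1 + u^{d(P)})) ). -/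

import Mathlib

/- Setting: `F_q[x]` with `q` prime, `q ≡ 1 (mod 4)`.  `M_n` denotes the monic
polynomials of degree `n`, `M_{≤n}` those of degree at most `n`, `H_n` the monic
squarefree polynomials of degree `n`. -/

open Polynomial

noncomputable section

attribute [local instance] Classical.propDecidable

abbrev Fqx (q : ℕ) := Polynomial (ZMod q)

/-- The (sub)type of monic irreducible polynomials over `F_q`. -/
abbrev MIrr (q : ℕ) := {P : Fqx q // P.Monic ∧ Irreducible P}

/-- The norm `|f| = q ^ deg f`, as a complex number. -/
def nm (q : ℕ) (f : Fqx q) : ℂ := (q : ℂ) ^ f.natDegree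

/-- The monic polynomial `X ^ n + ∑ i < n, c i * X ^ i` of degree `n`; as `c` runs over
`Fin n → ZMod q`, this enumerates the monic polynomials of degree `n` exactly once. -/
def monicOf (q n : ℕ) (c : Fin n → ZMod q) : Fqx q :=
  X ^ n + ∑ i : Fin n, C (c i) * X ^ (i : ℕ)

/-- The polynomial `∑ i < n, c i * X ^ i` of degree `< n`; as `c` runs over
`Fin n → ZMod q`, this enumerates the residues modulo a polynomial of degree `n`. -/
def polyOf (q n : ℕ) (c : Fin n → ZMod q) : Fqx q :=
  ∑ i : Fin n, C (c i) * X ^ (i : ℕ)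

/-- The sum of `F` over the monic polynomials of degree `n` (empty if `n < 0`). -/
def sumMn (q : ℕ) [NeZero q] (n : ℤ) (F : Fqx q → ℂ) : ℂ :=
  if 0 ≤ n then ∑ c : Fin n.toNat → ZMod q, F (monicOf q n.toNat c) else 0

/-- The sum of `F` over the monic polynomials of degree at most `n` (empty if `n < 0`). -/
def sumMle (q : ℕ) [NeZero q] (n : ℤ) (F : Fqx q → ℂ) : ℂ :=
  ∑ m ∈ Finset.range (n + 1).toNat, sumMn q m F

/-- The sum of `F` over `H_n`, the monic squarefree polynomials of degree `n`. -/
def sumH (q : ℕ) [NeZero q] (n : ℕ) (F : Fqx q → ℂ) : ℂ :=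
  ∑ c : Fin n → ZMod q,
    if Squarefree (monicOf q n c) then F (monicOf q n c) else 0

/-- The quadratic residue symbol `(f | P)` for `P` monic irreducible:  it is `0` if
`P ∣ f`, `1` if `P ∤ f` and `f` is a square modulo `P`, and `-1` otherwise. -/
def legSym (q : ℕ) (f P : Fqx q) : ℤ :=
  if P ∣ f then 0 else if ∃ g : Fqx q, P ∣ (g ^ 2 - f) then 1 else -1

/-- The Jacobi symbol `(f | u)`, extending the quadratic residue symbol
multiplicatively in the lower entry. -/
def jacSym (q : ℕ) [Fact q.Prime] (f u : Fqx q) : ℤ :=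
  if u = 0 then (if IsUnit f then 1 else 0)
  else ((UniqueFactorizationMonoid.factors u).map fun P => legSym q f P).prod

/-- The character `χ_D(f) = (D | f)`, as a complex number. -/
def chi (q : ℕ) [Fact q.Prime] (D f : Fqx q) : ℂ := jacSym q D f

/-- `d_k(f)`: the number of ways of writing `f` as an ordered product of `k` monic
polynomials. -/
def dk (q k : ℕ) (f : Fqx q) : ℕ :=
  Nat.card {t : Fin k → Fqx q // (∀ i, (t i).Monic) ∧ ∏ i, t i = f}

/-- The exponential `e(a/f) = exp(2πi a₁/q)`, where `a₁ ∈ F_q ≅ ℤ/q` is the coefficient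
of `1/x` in the Laurent expansion of `a/f` at infinity, i.e. the coefficient of
`x^(deg f - 1)` in `a mod f`. -/
def eQ (q : ℕ) (f a : Fqx q) : ℂ :=
  Complex.exp (2 * (Real.pi : ℂ) * Complex.I * (((a %ₘ f).coeff (f.natDegree - 1)).val : ℂ) / q)

/-- The generalized Gauss sum `G(V, χ_f) = ∑_{u mod f} χ_f(u) e(uV/f)`. -/
def gSum (q : ℕ) [Fact q.Prime] (V f : Fqx q) : ℂ :=
  ∑ c : Fin f.natDegree → ZMod q,
    chi q f (polyOf q f.natDegree c) * eQ q f (polyOf q f.natDegree c * V)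

/-- `L(1/2, χ_D)`: since `L(s, χ_D) = ∑_{f ∈ M} χ_D(f) |f|^{-s}` is a polynomial of
degree `deg D - 1` in `q^{-s}` (for `D` squarefree of odd degree), this is the finite
sum `∑_{n < deg D} (∑_{f ∈ M_n} χ_D(f)) q^{-n/2}`. -/
def Lhalf (q : ℕ) [Fact q.Prime] (D : Fqx q) : ℂ :=
  ∑ n ∈ Finset.range D.natDegree,
    sumMn q n (fun f => chi q D f) / (Real.sqrt ((q : ℝ) ^ n) : ℂ)

/-- The L-series `L(w, χ_V) = ∑_{f ∈ M} χ_V(f) w^(deg f)`. -/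
def Lser (q : ℕ) [Fact q.Prime] (V : Fqx q) (w : ℂ) : ℂ :=
  ∑' f : {f : Fqx q // f.Monic}, chi q V f.1 * w ^ f.1.natDegree

/-- The Euler phi function: the number of units in `F_q[x]/(f)`. -/
def polyPhi (q : ℕ) [Fact q.Prime] (f : Fqx q) : ℕ :=
  Nat.card ((Fqx q ⧸ Ideal.span {f}))ˣ

/-- `Z(u) = (1 - qu)⁻¹`. -/
def Zf (q : ℕ) (u : ℂ) : ℂ := (1 - q * u)⁻¹

/-- The Euler product `B(u) = ∏_P (1 + u^d(u^d - 3)/((|P|+1)(1+u^d)))`, `d = d(P)`. -/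
def Bfun (q : ℕ) (u : ℂ) : ℂ :=
  ∏' P : MIrr q, (1 + u ^ P.1.natDegree * (u ^ P.1.natDegree - 3) /
    ((nm q P.1 + 1) * (1 + u ^ P.1.natDegree)))

/-- The Euler product `B_3(u)` from the third-moment main term. -/
def B3fun (q : ℕ) (u : ℂ) : ℂ :=
  ∏' P : MIrr q,
    (1 - (6 * u ^ P.1.natDegree - (15 - 6 * nm q P.1) * u ^ (2 * P.1.natDegree)
      + (20 - 8 * nm q P.1) * u ^ (3 * P.1.natDegree)
      - (15 - 3 * nm q P.1) * u ^ (4 * P.1.natDegree)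
      + 6 * u ^ (5 * P.1.natDegree) - u ^ (6 * P.1.natDegree)) / (nm q P.1 + 1))

/-- `∑_{C ∈ M_{≤ g-1}, C | f^∞} |C|⁻²`, where `C | f^∞` means that every monic
irreducible factor of `C` divides `f`. -/
def sumCdiv (q : ℕ) [NeZero q] (g : ℕ) (f : Fqx q) : ℂ :=
  sumMle q ((g : ℤ) - 1) fun Cp =>
    if ∀ P : Fqx q, P.Monic → Irreducible P → P ∣ Cp → P ∣ f
    then ((q : ℂ) ^ (2 * Cp.natDegree))⁻¹ else 0

/-- The main term `q^(2g+1) (1 - 1/q) ∑_{f ∈ M_{≤N}, f = □} d_k(f) φ(f) |f|^{-3/2}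
∑_{C ∈ M_{≤g-1}, C|f^∞} |C|⁻²`. -/
def Mterm (q : ℕ) [Fact q.Prime] (k : ℕ) (N : ℤ) (g : ℕ) : ℂ :=
  (q : ℂ) ^ (2 * g + 1) * (1 - 1 / q) * sumMle q N fun f =>
    if IsSquare f then
      (dk q k f : ℂ) * polyPhi q f / (Real.sqrt ((q : ℝ) ^ (3 * f.natDegree)) : ℂ)
        * sumCdiv q g f
    else 0

/-- The secondary main term `S_{kg}(V = □)` (with `N = kg` or `kg - 1`). -/
def Ssq (q : ℕ) [Fact q.Prime] (k : ℕ) (N : ℤ) (g : ℕ) : ℂ :=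
  (q : ℂ) ^ (2 * g + 1) * sumMle q N fun f =>
    if Even f.natDegree then
      (dk q k f : ℂ) / (Real.sqrt ((q : ℝ) ^ (3 * f.natDegree)) : ℂ) *
        sumMle q ((g : ℤ) - 1) (fun Cp =>
          if ∀ P : Fqx q, P.Monic → Irreducible P → P ∣ Cp → P ∣ f then
            ((q : ℂ) ^ (2 * Cp.natDegree))⁻¹ *
              ((q - 1) * sumMle q ((f.natDegree : ℤ) / 2 - g - 2 + Cp.natDegree)
                  (fun l => gSum q (l ^ 2) f)
                - sumMn q ((f.natDegree : ℤ) / 2 - g - 1 + Cp.natDegree)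
                    (fun l => gSum q (l ^ 2) f)
                - (q - 1) / q * sumMle q ((f.natDegree : ℤ) / 2 - g - 1 + Cp.natDegree)
                    (fun l => gSum q (l ^ 2) f)
                + (1 / q) * sumMn q ((f.natDegree : ℤ) / 2 - g + Cp.natDegree)
                    (fun l => gSum q (l ^ 2) f))
          else 0)
    else 0

/-- The odd-degree part `S_{kg,o}` (with `N = kg` or `kg - 1`). -/
def Sodd (q : ℕ) [Fact q.Prime] (k : ℕ) (N : ℤ) (g : ℕ) : ℂ :=
  (q : ℂ) ^ (2 * g + 1) * (Real.sqrt q : ℂ) * sumMle q N fun f =>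
    if Odd f.natDegree then
      (dk q k f : ℂ) / (Real.sqrt ((q : ℝ) ^ (3 * f.natDegree)) : ℂ) *
        sumMle q ((g : ℤ) - 1) (fun Cp =>
          if ∀ P : Fqx q, P.Monic → Irreducible P → P ∣ Cp → P ∣ f then
            ((q : ℂ) ^ (2 * Cp.natDegree))⁻¹ *
              (sumMn q ((f.natDegree : ℤ) - 2 * g - 2 + 2 * Cp.natDegree)
                  (fun V => gSum q V f)
                - (1 / q) * sumMn q ((f.natDegree : ℤ) - 2 * g + 2 * Cp.natDegree)
                    (fun V => gSum q V f))
          else 0)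
    else 0

/-- The even-degree, non-square-`V` part `S_{kg,e}(V ≠ □)` (with `N = kg` or `kg-1`). -/
def SevNS (q : ℕ) [Fact q.Prime] (k : ℕ) (N : ℤ) (g : ℕ) : ℂ :=
  (q : ℂ) ^ (2 * g + 1) * sumMle q N fun f =>
    if Even f.natDegree then
      (dk q k f : ℂ) / (Real.sqrt ((q : ℝ) ^ (3 * f.natDegree)) : ℂ) *
        sumMle q ((g : ℤ) - 1) (fun Cp =>
          if ∀ P : Fqx q, P.Monic → Irreducible P → P ∣ Cp → P ∣ f then
            ((q : ℂ) ^ (2 * Cp.natDegree))⁻¹ *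
              ((q - 1) * sumMle q ((f.natDegree : ℤ) - 2 * g - 3 + 2 * Cp.natDegree)
                  (fun V => if IsSquare V then 0 else gSum q V f)
                - sumMn q ((f.natDegree : ℤ) - 2 * g - 2 + 2 * Cp.natDegree)
                    (fun V => if IsSquare V then 0 else gSum q V f)
                - (q - 1) / q * sumMle q ((f.natDegree : ℤ) - 2 * g - 1 + 2 * Cp.natDegree)
                    (fun V => if IsSquare V then 0 else gSum q V f)
                + (1 / q) * sumMn q ((f.natDegree : ℤ) - 2 * g + 2 * Cp.natDegree)
                    (fun V => if IsSquare V then 0 else gSum q V f))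
          else 0)
    else 0

/-- `∏_{P | f} (1 - |P|⁻² z^{-d(P)})`, a finite product written as a `tprod`. -/
def prodC (q : ℕ) (z : ℂ) (f : Fqx q) : ℂ :=
  ∏' P : {P : Fqx q // P.Monic ∧ Irreducible P ∧ P ∣ f},
    (1 - 1 / (nm q P.1 ^ 2 * z ^ P.1.natDegree))

/-- `M(V; z, w) = ∑_{f ∈ M} d₂(f) G(V,χ_f) / (√|f| ∏_{P|f}(1 - |P|⁻²z^{-d(P)})) w^(deg f)`. -/
def Mser (q : ℕ) [Fact q.Prime] (V : Fqx q) (z w : ℂ) : ℂ :=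
  ∑' f : {f : Fqx q // f.Monic},
    (dk q 2 f.1 : ℂ) * gSum q V f.1 /
      ((Real.sqrt ((q : ℝ) ^ f.1.natDegree) : ℂ) * prodC q z f.1) * w ^ f.1.natDegree

/-- The local factor `M_P(V; z, w)`. -/
def MPf (q : ℕ) [Fact q.Prime] (V : Fqx q) (z w : ℂ) (P : Fqx q) : ℂ :=
  if P ∣ V then
    1 + (1 - 1 / (nm q P ^ 2 * z ^ P.natDegree))⁻¹ *
      ∑' b : ℕ, (dk q 2 (P ^ (b + 1)) : ℂ) * gSum q V (P ^ (b + 1)) /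
        (Real.sqrt ((q : ℝ) ^ ((b + 1) * P.natDegree)) : ℂ) * w ^ ((b + 1) * P.natDegree)
  else
    1 + 2 * (jacSym q V P : ℂ) * w ^ P.natDegree / (nm q P ^ 2 * z ^ P.natDegree - 1)
      + w ^ (2 * P.natDegree)
      - 4 * w ^ (2 * P.natDegree) / (1 - 1 / (nm q P ^ 2 * z ^ P.natDegree))
      + 2 * (jacSym q V P : ℂ) * w ^ (3 * P.natDegree) /
          (1 - 1 / (nm q P ^ 2 * z ^ P.natDegree))

/-- The local factor `R_P(l²; z, w)`. -/
def RPf (q : ℕ) [Fact q.Prime] (l : Fqx q) (z w : ℂ) (P : Fqx q) : ℂ :=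
  if P ∣ l then
    (1 - w ^ P.natDegree) ^ 2 *
      (1 + (1 - 1 / (nm q P ^ 2 * z ^ P.natDegree))⁻¹ *
        ∑' b : ℕ, (dk q 2 (P ^ (b + 1)) : ℂ) * gSum q (l ^ 2) (P ^ (b + 1)) /
          (Real.sqrt ((q : ℝ) ^ ((b + 1) * P.natDegree)) : ℂ) * w ^ ((b + 1) * P.natDegree))
  else
    1 + 2 * w ^ P.natDegree / (nm q P ^ 2 * z ^ P.natDegree - 1)
      + w ^ (2 * P.natDegree)
      - 4 * w ^ (2 * P.natDegree) / (1 - 1 / (nm q P ^ 2 * z ^ P.natDegree))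
      + 2 * w ^ (3 * P.natDegree) / (1 - 1 / (nm q P ^ 2 * z ^ P.natDegree))

/-- `R(z, w) = ∑_{l ∈ M} z^(deg l) ∏_P R_P(l²; z, w)`. -/
def Rser (q : ℕ) [Fact q.Prime] (z w : ℂ) : ℂ :=
  ∑' l : {l : Fqx q // l.Monic}, z ^ l.1.natDegree * ∏' P : MIrr q, RPf q l.1 z w P.1

/-- The local factor `F_P(z, w)`. -/
def FPf (q : ℕ) (z w : ℂ) (P : Fqx q) : ℂ :=
  (1 - w ^ P.natDegree) ^ 2 *
    (1 - (1 - 2 * nm q P ^ 2 * (w * z) ^ P.natDegree - 2 * nm q P * (w ^ 2 * z) ^ P.natDegree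
        + 2 * nm q P ^ 2 * (w * z ^ 2) ^ P.natDegree
        + (-2 * nm q P ^ 3 + 3 * nm q P ^ 2) * (w ^ 2 * z ^ 2) ^ P.natDegree
        + nm q P ^ 2 * (w ^ 4 * z ^ 2) ^ P.natDegree
        - nm q P ^ 3 * (w ^ 4 * z ^ 3) ^ P.natDegree) /
      (nm q P ^ 2 * z ^ P.natDegree * (1 - nm q P * w ^ (2 * P.natDegree) * z ^ P.natDegree)))

/-- `F(z, w) = ∏_P F_P(z, w)`. -/
def Ffull (q : ℕ) (z w : ℂ) : ℂ := ∏' P : MIrr q, FPf q z w P.1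

/-- `F(z) = F(z, 1/q)`. -/
def Fone (q : ℕ) (z : ℂ) : ℂ := Ffull q z (1 / q)

/-- `α(z) = (1/q) ∂_w F(z, w)|_{w = 1/q} / F(z, 1/q)`. -/
def alphaF (q : ℕ) (z : ℂ) : ℂ := (1 / (q : ℂ)) * deriv (Ffull q z) (1 / q) / Fone q z

/-- The explicit formula for `F(z)`:
`∏_P (1 - 1/|P|)² (1 + 2/|P| + 1/|P|³ - (z^d + z^{-d})/|P|²)`. -/
def Fexp (q : ℕ) (z : ℂ) : ℂ :=
  ∏' P : MIrr q,
    ((1 - 1 / nm q P.1) ^ 2 *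
      (1 + 2 / nm q P.1 + 1 / nm q P.1 ^ 3 -
        (z ^ P.1.natDegree + z⁻¹ ^ P.1.natDegree) / nm q P.1 ^ 2))

/-- The explicit formula for `α(z)`. -/
def alphaExp (q : ℕ) (z : ℂ) : ℂ :=
  ∑' P : MIrr q,
    2 * (P.1.natDegree : ℂ) *
      (nm q P.1 ^ 2 + z ^ P.1.natDegree * (-3 * nm q P.1 ^ 3 - 3 * nm q P.1 + nm q P.1 ^ 2)
        + z ^ (2 * P.1.natDegree) * (nm q P.1 ^ 4 - nm q P.1 ^ 3 + 4 * nm q P.1 ^ 2 - nm q P.1 + 2)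
        + z ^ (3 * P.1.natDegree) * (nm q P.1 ^ 2 - 2 * nm q P.1)) /
      ((nm q P.1 - 1) * (z ^ P.1.natDegree - nm q P.1) *
        (nm q P.1 - z ^ P.1.natDegree - 2 * nm q P.1 ^ 2 * z ^ P.1.natDegree
          - nm q P.1 ^ 3 * z ^ P.1.natDegree + nm q P.1 * z ^ (2 * P.1.natDegree)))

/-- `A(V; z, w) = ∑_{f ∈ M} w^(deg f) d₃(f) G(V,χ_f)/(√|f| ∏_{P|f}(1 - |P|⁻²z^{-d(P)}))`. -/
def Aser (q : ℕ) [Fact q.Prime] (V : Fqx q) (z w : ℂ) : ℂ :=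
  ∑' f : {f : Fqx q // f.Monic},
    w ^ f.1.natDegree * (dk q 3 f.1 : ℂ) * gSum q V f.1 /
      ((Real.sqrt ((q : ℝ) ^ f.1.natDegree) : ℂ) * prodC q z f.1)

/-- The local factor `H_P(V; z, w)` of `A(V; z, w)`. -/
def HP3f (q : ℕ) [Fact q.Prime] (V : Fqx q) (z w : ℂ) (P : Fqx q) : ℂ :=
  if P ∣ V then
    1 + (1 - 1 / (nm q P ^ 2 * z ^ P.natDegree))⁻¹ *
      ∑' i : ℕ, w ^ ((i + 1) * P.natDegree) * (dk q 3 (P ^ (i + 1)) : ℂ) *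
        gSum q V (P ^ (i + 1)) / (Real.sqrt ((q : ℝ) ^ ((i + 1) * P.natDegree)) : ℂ)
  else
    1 + 3 * (jacSym q V P : ℂ) * w ^ P.natDegree / (nm q P ^ 2 * z ^ P.natDegree - 1)
      + 3 * w ^ (2 * P.natDegree)
      - 9 * w ^ (2 * P.natDegree) / (1 - 1 / (nm q P ^ 2 * z ^ P.natDegree))
      - (jacSym q V P : ℂ) * w ^ (3 * P.natDegree)
      + 9 * (jacSym q V P : ℂ) * w ^ (3 * P.natDegree) /
          (1 - 1 / (nm q P ^ 2 * z ^ P.natDegree))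
      - 3 * w ^ (4 * P.natDegree) / (1 - 1 / (nm q P ^ 2 * z ^ P.natDegree))

/-- The local factor `A_P(l²; z, w)`. -/
def APf (q : ℕ) [Fact q.Prime] (l : Fqx q) (z w : ℂ) (P : Fqx q) : ℂ :=
  if P ∣ l then
    (1 - w ^ P.natDegree) ^ 3 *
      (1 + ∑' i : ℕ, w ^ ((i + 1) * P.natDegree) * (dk q 3 (P ^ (i + 1)) : ℂ) *
        gSum q (l ^ 2) (P ^ (i + 1)) /
          ((Real.sqrt ((q : ℝ) ^ ((i + 1) * P.natDegree)) : ℂ) *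
            (1 - 1 / (nm q P ^ 2 * z ^ P.natDegree))))
  else
    1 + 3 * w ^ P.natDegree / (nm q P ^ 2 * z ^ P.natDegree - 1)
      + 3 * w ^ (2 * P.natDegree)
      - 9 * w ^ (2 * P.natDegree) / (1 - 1 / (nm q P ^ 2 * z ^ P.natDegree))
      - w ^ (3 * P.natDegree)
      + 9 * w ^ (3 * P.natDegree) / (1 - 1 / (nm q P ^ 2 * z ^ P.natDegree))
      - 3 * w ^ (4 * P.natDegree) / (1 - 1 / (nm q P ^ 2 * z ^ P.natDegree))

/-- `C(z, w) = ∑_{l ∈ M} z^(deg l) ∏_P A_P(l²; z, w)`. -/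
def Cser (q : ℕ) [Fact q.Prime] (z w : ℂ) : ℂ :=
  ∑' l : {l : Fqx q // l.Monic}, z ^ l.1.natDegree * ∏' P : MIrr q, APf q l.1 z w P.1

/-- The local factor `H_P(z, w)`. -/
def HPf (q : ℕ) (z w : ℂ) (P : Fqx q) : ℂ :=
  (1 - w ^ P.natDegree) ^ 3 * (1 - nm q P * (w ^ 2 * z) ^ P.natDegree) ^ 3 *
    (1 + (w * z) ^ P.natDegree) ^ 3 *
    (1 + 3 * w ^ P.natDegree + 3 * nm q P * (z * w ^ 2) ^ P.natDegree
      + 3 * w ^ (2 * P.natDegree) / nm q P - 3 * (z * w) ^ P.natDegree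
      - 1 / (nm q P ^ 2 * z ^ P.natDegree) - 6 * (z * w ^ 2) ^ P.natDegree
      + nm q P * (z * w ^ 3) ^ P.natDegree - 3 * (z * w ^ 4) ^ P.natDegree
      - nm q P * (z ^ 2 * w ^ 3) ^ P.natDegree + 3 * nm q P * (z ^ 2 * w ^ 4) ^ P.natDegree
      + nm q P * (z ^ 2 * w ^ 6) ^ P.natDegree - nm q P ^ 2 * (z ^ 3 * w ^ 6) ^ P.natDegree)

/-- `H(z, w) = ∏_P H_P(z, w)`. -/
def Hfull (q : ℕ) (z w : ℂ) : ℂ := ∏' P : MIrr q, HPf q z w P.1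

end

/-- Finitely supported functions with support in `insert a s` split as a value at `a` and a
function supported in `s`. -/
noncomputable def Finsupp.supportSubsetInsertEquiv {ι : Type*} [DecidableEq ι] {a : ι}
    {s : Finset ι} (ha : a ∉ s) :
    {b : ι →₀ ℕ // b.support ⊆ insert a s} ≃ ℕ × {b : ι →₀ ℕ // b.support ⊆ s} where
  toFun b := (b.1 a, ⟨b.1.erase a, by
    intro i hi
    rw [Finsupp.support_erase, Finset.mem_erase] at hi
    exact (Finset.mem_insert.mp (b.2 hi.2)).resolve_left hi.1⟩)
  invFun p := ⟨p.2.1 + Finsupp.single a p.1, by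
    intro i hi
    rcases Finset.mem_union.mp (Finsupp.support_add hi) with h | h
    · exact Finset.mem_insert_of_mem (p.2.2 h)
    · exact Finset.mem_insert.mpr (Or.inl (Finset.mem_singleton.mp
        (Finsupp.support_single_subset h)))⟩
  left_inv b := by
    ext i
    by_cases h : i = a <;> simp [h]
  right_inv p := by
    have h0 : p.2.1 a = 0 := Finsupp.notMem_support_iff.mp fun h => ha (p.2.2 h)
    refine Prod.ext (by simp [h0]) (Subtype.ext ?_)
    ext i
    by_cases h : i = a
    · simp [h, h0]
    · simp [h]

section EulerProduct

variable {ι 𝕜 : Type*} [NormedField 𝕜] {f : ι → ℕ → 𝕜}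

theorem Finsupp.norm_prod_eq (b : ι →₀ ℕ) : ‖b.prod f‖ = b.prod fun i n => ‖f i n‖ :=
  norm_prod _ _

theorem summable_norm_and_hasSum_prod_of_support_subset [CompleteSpace 𝕜] (h0 : ∀ i, f i 0 = 1)
    (hs : ∀ i, Summable fun n => ‖f i n‖) (s : Finset ι) :
    (Summable fun b : {b : ι →₀ ℕ // b.support ⊆ s} => ‖b.1.prod f‖) ∧
      HasSum (fun b : {b : ι →₀ ℕ // b.support ⊆ s} => b.1.prod f)
        (∏ i ∈ s, ∑' n, f i n) := by
  classical
  induction s using Finset.induction_on with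
  | empty =>
    have hu : ∀ b : {b : ι →₀ ℕ // b.support ⊆ (∅ : Finset ι)}, b = ⟨0, by simp⟩ := fun b =>
      Subtype.ext (Finsupp.support_eq_empty.mp (Finset.subset_empty.mp b.2))
    have : Unique {b : ι →₀ ℕ // b.support ⊆ (∅ : Finset ι)} := ⟨⟨⟨0, by simp⟩⟩, hu⟩
    refine ⟨(hasSum_unique _).summable, ?_⟩
    convert hasSum_unique _ using 1
    rw [hu default]
    simp
  | insert a s ha ih =>
    have key : ∀ p : ℕ × {b : ι →₀ ℕ // b.support ⊆ s},
        ((Finsupp.supportSubsetInsertEquiv ha).symm p).1.prod f = f a p.1 * p.2.1.prod f := by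
      rintro ⟨n, b, hb⟩
      change (b + Finsupp.single a n).prod f = f a n * b.prod f
      rw [Finsupp.prod_add_index_of_disjoint, Finsupp.prod_single_index (h0 a), mul_comm]
      exact Disjoint.mono_right Finsupp.support_single_subset
        (Finset.disjoint_singleton_right.mpr fun h => ha (hb h))
    have hn := (hs a).mul_norm ih.1
    refine ⟨(Finsupp.supportSubsetInsertEquiv ha).symm.summable_iff.mp ?_,
      (Finsupp.supportSubsetInsertEquiv ha).symm.hasSum_iff.mp ?_⟩
    · refine hn.congr fun p => ?_
      simp only [Function.comp, key]
    · have := (summable_mul_of_summable_norm (hs a) ih.1).hasSum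
      rw [← tsum_mul_tsum_of_summable_norm (hs a) ih.1, ih.2.tsum_eq] at this
      rw [Finset.prod_insert ha]
      refine this.congr_fun ?_
      intro p
      simp only [Function.comp, key]

theorem summable_norm_finsupp_prod (h0 : ∀ i, f i 0 = 1)
    (hs : ∀ i, Summable fun n => ‖f i n‖) (hsum : Summable fun i => ∑' n, ‖f i (n + 1)‖) :
    Summable fun b : ι →₀ ℕ => ‖b.prod f‖ := by
  classical
  refine summable_of_sum_le (c := Real.exp (∑' i, ∑' n, ‖f i (n + 1)‖))
    (fun _ => norm_nonneg _) fun T => ?_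
  have hr := summable_norm_and_hasSum_prod_of_support_subset (f := fun i n => ‖f i n‖)
    (fun i => by simp [h0]) (fun i => by simpa using hs i) (T.biUnion Finsupp.support)
  have hT : ∀ b ∈ T, b.support ⊆ T.biUnion Finsupp.support := fun b hb =>
    Finset.subset_biUnion_of_mem _ hb
  calc ∑ b ∈ T, ‖b.prod f‖
      = ∑ b ∈ T.subtype (fun b => b.support ⊆ T.biUnion Finsupp.support),
          b.1.prod (fun i n => ‖f i n‖) := by
        rw [Finset.sum_subtype_of_mem (f := fun b : ι →₀ ℕ => b.prod fun i n => ‖f i n‖) hT]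
        exact Finset.sum_congr rfl fun b _ => Finsupp.norm_prod_eq b
    _ ≤ ∏ i ∈ T.biUnion Finsupp.support, ∑' n, ‖f i n‖ :=
        sum_le_hasSum _ (fun b _ => Finset.prod_nonneg fun _ _ => norm_nonneg _) hr.2
    _ ≤ ∏ i ∈ T.biUnion Finsupp.support, Real.exp (∑' n, ‖f i (n + 1)‖) := by
        refine Finset.prod_le_prod (fun i _ => tsum_nonneg fun _ => norm_nonneg _) fun i _ => ?_
        rw [(hs i).tsum_eq_zero_add, h0, norm_one, add_comm]
        exact Real.add_one_le_exp _
    _ ≤ Real.exp (∑' i, ∑' n, ‖f i (n + 1)‖) := by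
        rw [← Real.exp_sum]
        exact Real.exp_le_exp.mpr (hsum.sum_le_tsum _ fun i _ => tsum_nonneg fun _ => norm_nonneg _)

theorem hasProd_tsum_finsupp_prod [CompleteSpace 𝕜] (h0 : ∀ i, f i 0 = 1)
    (hs : ∀ i, Summable fun n => ‖f i n‖) (hsum : Summable fun i => ∑' n, ‖f i (n + 1)‖) :
    HasProd (fun i => ∑' n, f i n) (∑' b : ι →₀ ℕ, b.prod f) := by
  classical
  have hS := summable_norm_finsupp_prod h0 hs hsum
  have hfin : ∀ s : Finset ι, ∏ i ∈ s, ∑' n, f i n =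
      ∑' b : ι →₀ ℕ, Set.indicator {b : ι →₀ ℕ | b.support ⊆ s} (fun b : ι →₀ ℕ => b.prod f) b :=
        fun s => by
    rw [← tsum_subtype, ← (summable_norm_and_hasSum_prod_of_support_subset h0 hs s).2.tsum_eq]
    rfl
  change Filter.Tendsto (fun s : Finset ι => ∏ i ∈ s, ∑' n, f i n) Filter.atTop _
  simp only [hfin]
  refine tendsto_tsum_of_dominated_convergence hS (fun b => ?_)
    (Filter.Eventually.of_forall fun s b => norm_indicator_le_norm_self _ _)
  refine tendsto_const_nhds.congr' ?_
  filter_upwards [Filter.eventually_ge_atTop b.support] with s hs'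
  exact (Set.indicator_of_mem (s := {b : ι →₀ ℕ | b.support ⊆ s}) (f := fun b => b.prod f) hs').symm

end EulerProduct

section MonicPolynomials

variable {q : ℕ}

/-- The monic polynomial with prescribed exponents at the monic irreducible polynomials. -/
noncomputable def polyOfExponents (b : MIrr q →₀ ℕ) : Fqx q :=
  b.prod fun P n => P.1 ^ n

theorem monic_polyOfExponents (b : MIrr q →₀ ℕ) : (polyOfExponents b).Monic :=
  monic_prod_of_monic _ _ fun P _ => P.2.1.pow _

@[simp]
theorem polyOfExponents_zero : polyOfExponents (0 : MIrr q →₀ ℕ) = 1 := Finsupp.prod_zero_index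

theorem polyOfExponents_add (b c : MIrr q →₀ ℕ) :
    polyOfExponents (b + c) = polyOfExponents b * polyOfExponents c :=
  Finsupp.prod_add_index' (fun _ => pow_zero _) fun _ _ _ => pow_add _ _ _

theorem polyOfExponents_single (P : MIrr q) (n : ℕ) :
    polyOfExponents (Finsupp.single P n) = P.1 ^ n :=
  Finsupp.prod_single_index (pow_zero _)

variable [Fact q.Prime]

theorem natDegree_polyOfExponents (b : MIrr q →₀ ℕ) :
    (polyOfExponents b).natDegree = b.sum fun P n => n * P.1.natDegree := by
  rw [polyOfExponents, Finsupp.prod, natDegree_prod_of_monic _ _ fun P _ => P.2.1.pow _]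
  exact Finset.sum_congr rfl fun P _ => P.2.1.natDegree_pow _

theorem pow_natDegree_polyOfExponents {R : Type*} [CommMonoid R] (x : R) (b : MIrr q →₀ ℕ) :
    x ^ (polyOfExponents b).natDegree = b.prod fun P n => x ^ (n * P.1.natDegree) := by
  rw [natDegree_polyOfExponents, Finsupp.sum, ← Finset.prod_pow_eq_pow_sum]
  rfl

theorem dvd_polyOfExponents_iff (P : MIrr q) (b : MIrr q →₀ ℕ) :
    P.1 ∣ polyOfExponents b ↔ b P ≠ 0 := by
  rw [polyOfExponents, Finsupp.prod, P.2.2.prime.dvd_finsetProd_iff]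
  constructor
  · rintro ⟨Q, hQ, h⟩
    have h1 := (P.2.2.dvd_irreducible_iff_associated Q.2.2).mp (P.2.2.prime.dvd_of_dvd_pow h)
    have h2 : P = Q := Subtype.ext (eq_of_monic_of_associated P.2.1 Q.2.1 h1)
    exact h2 ▸ Finsupp.mem_support_iff.mp hQ
  · exact fun h => ⟨P, Finsupp.mem_support_iff.mpr h, dvd_pow_self _ h⟩

theorem normalizedFactors_polyOfExponents (b : MIrr q →₀ ℕ) :
    UniqueFactorizationMonoid.normalizedFactors (polyOfExponents b) =
      (Finsupp.toMultiset b).map Subtype.val := by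
  induction b using Finsupp.induction with
  | zero => simp
  | single_add P n b _ _ ih =>
    rw [polyOfExponents_add, UniqueFactorizationMonoid.normalizedFactors_mul
      (monic_polyOfExponents _).ne_zero (monic_polyOfExponents _).ne_zero, ih,
      polyOfExponents_single, UniqueFactorizationMonoid.normalizedFactors_pow,
      UniqueFactorizationMonoid.normalizedFactors_irreducible P.2.2, P.2.1.normalize_eq_self,
      map_add, Finsupp.toMultiset_single, Multiset.map_add, Multiset.map_nsmul,
      Multiset.map_singleton]

theorem polyOfExponents_injective :
    Function.Injective (polyOfExponents : (MIrr q →₀ ℕ) → Fqx q) := fun b c h => by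
  have h' := congrArg UniqueFactorizationMonoid.normalizedFactors h
  rw [normalizedFactors_polyOfExponents, normalizedFactors_polyOfExponents] at h'
  exact Multiset.toFinsupp.symm.injective (Multiset.map_injective Subtype.val_injective h')

theorem exists_polyOfExponents_eq {f : Fqx q} (hf : f.Monic) : ∃ b, polyOfExponents b = f := by
  suffices ∀ s : Multiset (Fqx q), (∀ P ∈ s, P.Monic ∧ Irreducible P) →
      ∃ b, polyOfExponents b = s.prod by
    obtain ⟨b, hb⟩ := this (UniqueFactorizationMonoid.normalizedFactors f) fun P hP => by
      have := (Polynomial.mem_normalizedFactors_iff hf.ne_zero).mp hP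
      exact ⟨this.2.1, this.1⟩
    refine ⟨b, hb.trans (eq_of_monic_of_associated (hb ▸ monic_polyOfExponents b) hf ?_)⟩
    exact UniqueFactorizationMonoid.prod_normalizedFactors hf.ne_zero
  intro s
  induction s using Multiset.induction_on with
  | empty => exact fun _ => ⟨0, by simp⟩
  | cons P s ih =>
    intro h
    obtain ⟨b, hb⟩ := ih fun Q hQ => h Q (Multiset.mem_cons_of_mem hQ)
    refine ⟨Finsupp.single ⟨P, h P (Multiset.mem_cons_self P s)⟩ 1 + b, ?_⟩
    rw [polyOfExponents_add, hb, polyOfExponents_single, pow_one, Multiset.prod_cons]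

/-- Unique factorization: exponent vectors correspond to monic polynomials. -/
noncomputable def exponentsEquiv : (MIrr q →₀ ℕ) ≃ {f : Fqx q // f.Monic} :=
  Equiv.ofBijective (fun b => ⟨polyOfExponents b, monic_polyOfExponents b⟩)
    ⟨fun _ _ h => polyOfExponents_injective (congrArg Subtype.val h),
      fun f => (exists_polyOfExponents_eq f.2).imp fun _ h => Subtype.ext h⟩

theorem dk_two_polyOfExponents (b : MIrr q →₀ ℕ) :
    dk q 2 (polyOfExponents b) = b.prod fun _ n => n + 1 := by
  classical
  have h : Nat.card (Finset.Iic b) = dk q 2 (polyOfExponents b) := by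
    refine Nat.card_eq_of_bijective
      (fun c => ⟨![polyOfExponents c.1, polyOfExponents (b - c.1)], fun i => ?_, ?_⟩) ⟨?_, ?_⟩
    · fin_cases i
      · exact monic_polyOfExponents _
      · exact monic_polyOfExponents _
    · rw [Fin.prod_univ_two]
      change polyOfExponents c.1 * polyOfExponents (b - c.1) = _
      rw [← polyOfExponents_add, add_tsub_cancel_of_le (Finset.mem_Iic.mp c.2)]
    · intro c d h
      exact Subtype.ext (polyOfExponents_injective (congrFun (congrArg Subtype.val h) 0))
    · rintro ⟨t, ht, hp⟩
      obtain ⟨c, hc⟩ := exists_polyOfExponents_eq (ht 0)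
      obtain ⟨d, hd⟩ := exists_polyOfExponents_eq (ht 1)
      rw [Fin.prod_univ_two, ← hc, ← hd, ← polyOfExponents_add] at hp
      have hb := polyOfExponents_injective hp
      refine ⟨⟨c, Finset.mem_Iic.mpr (hb ▸ le_self_add)⟩, Subtype.ext ?_⟩
      funext i
      fin_cases i
      · exact hc
      · change polyOfExponents (b - c) = t 1
        rw [← hb, add_tsub_cancel_left, hd]
  rw [← h, Nat.card_eq_fintype_card, Fintype.card_coe, Finsupp.card_Iic]
  exact Finset.prod_congr rfl fun P _ => Nat.card_Iic _

theorem natCard_quotient_span {f : Fqx q} (hf : f ≠ 0) :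
    Nat.card (Fqx q ⧸ Ideal.span {f}) = q ^ f.natDegree := by
  have : Module.Finite (ZMod q) (Fqx q ⧸ Ideal.span {f}) :=
    (AdjoinRoot.powerBasis hf).finite
  rw [Module.natCard_eq_pow_finrank (K := ZMod q), finrank_quotient_span_eq_natDegree,
    Nat.card_zmod]

end MonicPolynomials

section EulerPhi

variable {q : ℕ} [Fact q.Prime]

theorem polyPhi_mul {f g : Fqx q} (h : IsCoprime f g) :
    polyPhi q (f * g) = polyPhi q f * polyPhi q g := by
  have h' : IsCoprime (Ideal.span {f}) (Ideal.span {g}) :=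
    Ideal.isCoprime_span_singleton_iff f g |>.mpr h
  rw [polyPhi, polyPhi, polyPhi, ← Ideal.span_singleton_mul_span_singleton,
    Nat.card_congr (Units.mapEquiv
      (Ideal.quotientMulEquivQuotientProd _ _ h').toMulEquiv).toEquiv,
    Nat.card_congr MulEquiv.prodUnits.toEquiv, Nat.card_prod]

theorem polyPhi_pow_succ (P : MIrr q) (n : ℕ) :
    polyPhi q (P.1 ^ (n + 1)) + q ^ (n * P.1.natDegree) = q ^ ((n + 1) * P.1.natDegree) := by
  have hP0 : P.1 ≠ 0 := P.2.2.ne_zero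
  set I : Ideal (Fqx q) := Ideal.span {P.1} with hI
  have hmax : I.IsMaximal := PrincipalIdealRing.isMaximal_of_irreducible P.2.2
  have hA : Nat.card (Fqx q ⧸ I ^ (n + 1)) = q ^ ((n + 1) * P.1.natDegree) := by
    rw [hI, Ideal.span_singleton_pow, natCard_quotient_span (pow_ne_zero _ hP0),
      P.2.1.natDegree_pow]
  have hfin : Finite (Fqx q ⧸ I ^ (n + 1)) := Nat.finite_of_card_ne_zero (by
    rw [hA]; exact pow_ne_zero _ (NeZero.ne q))
  set J : Ideal (Fqx q ⧸ I ^ (n + 1)) := I.map (Ideal.Quotient.mk (I ^ (n + 1))) with hJ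
  have hJcard : Nat.card J = q ^ (n * P.1.natDegree) := by
    have h1 := Submodule.card_eq_card_quotient_mul_card J
    rw [hA, Nat.card_congr (DoubleQuot.quotQuotEquivQuotOfLE
      (Ideal.pow_le_self n.succ_ne_zero)).toEquiv, natCard_quotient_span hP0, add_mul, one_mul,
      pow_add] at h1
    exact (mul_right_cancel₀ (pow_ne_zero _ (NeZero.ne q)) h1).symm
  have hmem : ∀ x : Fqx q ⧸ I ^ (n + 1), IsUnit x ↔ x ∉ J := fun x => by
    obtain ⟨a, rfl⟩ := Ideal.Quotient.mk_surjective x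
    rw [Ideal.Quotient.isUnit_mk_pow_iff_notMem I n.succ_ne_zero, hJ,
      Ideal.mem_quotient_iff_mem (Ideal.pow_le_self n.succ_ne_zero)]
  have hu : polyPhi q (P.1 ^ (n + 1)) = Set.ncard ((J : Set (Fqx q ⧸ I ^ (n + 1)))ᶜ) := by
    rw [polyPhi, ← Ideal.span_singleton_pow, ← hI, ← Nat.card_coe_set_eq]
    refine Nat.card_eq_of_bijective (fun u => ⟨u.1, (hmem _).mp u.isUnit⟩) ⟨?_, ?_⟩
    · exact fun u v h => Units.ext (congrArg Subtype.val h)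
    · rintro ⟨x, hx⟩
      obtain ⟨u, rfl⟩ := (hmem x).mpr hx
      exact ⟨u, rfl⟩
  rw [hu, ← hJcard, ← hA, add_comm]
  exact Set.ncard_add_ncard_compl (J : Set (Fqx q ⧸ I ^ (n + 1)))

theorem polyPhi_polyOfExponents (b : MIrr q →₀ ℕ) :
    (polyPhi q (polyOfExponents b) : ℂ) = nm q (polyOfExponents b) *
      b.prod fun P n => if n = 0 then 1 else 1 - 1 / nm q P.1 := by
  have hq : (q : ℂ) ≠ 0 := NeZero.ne _
  induction b using Finsupp.induction with
  | zero =>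
    have : Subsingleton (Fqx q ⧸ Ideal.span {(1 : Fqx q)}) := by
      rw [Ideal.span_singleton_one]; infer_instance
    rw [polyOfExponents_zero, polyPhi, Nat.card_unique]
    simp [nm]
  | single_add P n b hb hn ih =>
    obtain ⟨m, rfl⟩ := Nat.exists_eq_add_one_of_ne_zero hn
    have hcop : IsCoprime (P.1 ^ (m + 1)) (polyOfExponents b) := by
      refine IsCoprime.pow_left ((P.2.2.coprime_iff_not_dvd).mpr ?_)
      rw [dvd_polyOfExponents_iff, not_not]
      exact Finsupp.notMem_support_iff.mp hb
    have hP := congrArg (Nat.cast : ℕ → ℂ) (polyPhi_pow_succ P m)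
    push_cast at hP
    rw [polyOfExponents_add, polyOfExponents_single, polyPhi_mul hcop, Nat.cast_mul, ih,
      Finsupp.prod_add_index_of_disjoint, Finsupp.prod_single_index (by simp),
      if_neg m.succ_ne_zero, eq_sub_of_add_eq hP]
    · rw [nm, nm, nm, natDegree_mul (pow_ne_zero _ P.2.2.ne_zero) (monic_polyOfExponents b).ne_zero,
        P.2.1.natDegree_pow]
      field_simp
      ring
    · exact Disjoint.mono_left Finsupp.support_single_subset (Finset.disjoint_singleton_left.mpr hb)

end EulerPhi

section Enumeration

variable {q : ℕ}

theorem degree_sum_C_mul_X_pow_lt (n : ℕ) (c : Fin n → ZMod q) :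
    (∑ i : Fin n, C (c i) * X ^ (i : ℕ)).degree < (n : WithBot ℕ) := by
  rw [← mem_degreeLT]
  exact Submodule.sum_mem _ fun i _ => mem_degreeLT.mpr
    ((degree_C_mul_X_pow_le _ _).trans_lt (Nat.cast_lt.mpr i.2))

theorem monic_monicOf (n : ℕ) (c : Fin n → ZMod q) : (monicOf q n c).Monic :=
  monic_X_pow_add (degree_sum_C_mul_X_pow_lt n c)

theorem coeff_monicOf {n : ℕ} (c : Fin n → ZMod q) (i : Fin n) :
    (monicOf q n c).coeff i = c i := by
  rw [monicOf, coeff_add, coeff_X_pow, if_neg i.2.ne, zero_add, finsetSum_coeff,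
    Finset.sum_eq_single i]
  · simp
  · intro j _ hj
    rw [coeff_C_mul_X_pow, if_neg fun h => hj (Fin.ext h.symm)]
  · simp

variable [Fact q.Prime]

theorem natDegree_monicOf (n : ℕ) (c : Fin n → ZMod q) : (monicOf q n c).natDegree = n := by
  refine natDegree_eq_of_degree_eq_some ?_
  rw [monicOf, degree_add_eq_left_of_degree_lt, degree_X_pow]
  rw [degree_X_pow]
  exact degree_sum_C_mul_X_pow_lt n c

/-- The enumeration of monic polynomials by degree and lower coefficients. -/
noncomputable def monicEquiv (q : ℕ) [Fact q.Prime] :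
    (Σ n : ℕ, Fin n → ZMod q) ≃ {f : Fqx q // f.Monic} :=
  Equiv.ofBijective (fun p => ⟨monicOf q p.1 p.2, monic_monicOf p.1 p.2⟩) <| by
    refine ⟨?_, ?_⟩
    · rintro ⟨n, c⟩ ⟨m, d⟩ h
      have h' : monicOf q n c = monicOf q m d := congrArg Subtype.val h
      obtain rfl : n = m := by rw [← natDegree_monicOf n c, h', natDegree_monicOf]
      congr 1
      funext i
      rw [← coeff_monicOf c i, h', coeff_monicOf]
    · rintro ⟨f, hf⟩
      refine ⟨⟨f.natDegree, fun i => f.coeff i⟩, Subtype.ext ?_⟩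
      change monicOf q _ _ = f
      conv_rhs => rw [hf.as_sum]
      rw [monicOf, Finset.sum_range]

theorem natDegree_monicEquiv (p : Σ n : ℕ, Fin n → ZMod q) :
    (monicEquiv q p).1.natDegree = p.1 :=
  natDegree_monicOf p.1 p.2

/-- The finite set of monic polynomials of degree less than `N`. -/
noncomputable def monicsBelow (q : ℕ) [Fact q.Prime] (N : ℕ) : Finset {f : Fqx q // f.Monic} :=
  ((Finset.range N).sigma fun _ => Finset.univ).map (monicEquiv q).toEmbedding

theorem mem_monicsBelow {N : ℕ} {f : {f : Fqx q // f.Monic}} :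
    f ∈ monicsBelow q N ↔ f.1.natDegree < N := by
  obtain ⟨p, rfl⟩ := (monicEquiv q).surjective f
  rw [natDegree_monicEquiv, monicsBelow, Finset.mem_map_equiv]
  simp

theorem sumMn_natCast (n : ℕ) (F : Fqx q → ℂ) :
    sumMn q n F = ∑ c : Fin n → ZMod q, F (monicOf q n c) := by
  simp [sumMn]

theorem sumMle_eq_sum_monicsBelow (n : ℤ) (F : Fqx q → ℂ) :
    sumMle q n F = ∑ f ∈ monicsBelow q (n + 1).toNat, F f.1 := by
  rw [sumMle, monicsBelow, Finset.sum_map, Finset.sum_sigma]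
  exact Finset.sum_congr rfl fun m _ => sumMn_natCast m F

theorem hasSum_sumMn {F : Fqx q → ℂ} {a : ℂ}
    (h : HasSum (fun f : {f : Fqx q // f.Monic} => F f.1) a) :
    HasSum (fun n : ℕ => sumMn q n F) a := by
  have h' := ((monicEquiv q).hasSum_iff.mpr h).sigma fun n => hasSum_fintype _
  refine h'.congr_fun fun n => ?_
  exact sumMn_natCast n F

theorem summable_norm_pow_natDegree {x : ℝ} (hx0 : 0 ≤ x) (hx : x < 1 / q) :
    Summable fun f : {f : Fqx q // f.Monic} => x ^ f.1.natDegree := by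
  have hq : (0 : ℝ) < q := Nat.cast_pos.mpr (NeZero.pos q)
  rw [← (monicEquiv q).summable_iff]
  refine (summable_sigma_of_nonneg fun p => pow_nonneg hx0 _).mpr
    ⟨fun n => (hasSum_fintype _).summable, ?_⟩
  have : Summable fun n : ℕ => (q * x) ^ n :=
    summable_geometric_of_lt_one (by positivity) (by rwa [lt_div_iff₀' hq] at hx)
  refine this.congr fun n => ?_
  rw [tsum_fintype]
  simp [natDegree_monicEquiv, mul_pow]

theorem hasSum_pow_natDegree {u : ℂ} (hu : ‖u‖ < 1 / q) :
    HasSum (fun f : {f : Fqx q // f.Monic} => u ^ f.1.natDegree) (1 - q * u)⁻¹ := by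
  have hq : (0 : ℝ) < q := Nat.cast_pos.mpr (NeZero.pos q)
  have h1 : Summable fun f : {f : Fqx q // f.Monic} => u ^ f.1.natDegree :=
    Summable.of_norm (by simpa using summable_norm_pow_natDegree (norm_nonneg u) hu)
  have h2 := hasSum_sumMn (F := fun f => u ^ f.natDegree) h1.hasSum
  have h3 : HasSum (fun n : ℕ => sumMn q n fun f => u ^ f.natDegree) (1 - q * u)⁻¹ := by
    refine (hasSum_geometric_of_norm_lt_one (ξ := (q : ℂ) * u) ?_).congr_fun fun n => ?_
    · rw [norm_mul, Complex.norm_natCast]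
      rwa [lt_div_iff₀' hq] at hu
    · rw [sumMn_natCast]
      simp [natDegree_monicOf, mul_pow]
  rw [← h2.unique h3]
  exact h1.hasSum

theorem sum_monicsBelow_ite_isSquare {N M : ℕ} (hNM : ∀ d : ℕ, 2 * d < N ↔ d < M)
    (F : Fqx q → ℂ) (p : Fqx q → Prop) [DecidablePred p] (hp : ∀ f, p f ↔ IsSquare f) :
    ∑ f ∈ monicsBelow q N, (if p f.1 then F f.1 else 0) =
      ∑ l ∈ monicsBelow q M, F (l.1 ^ 2) := by
  rw [← Finset.sum_filter]
  symm
  refine Finset.sum_bij (fun l _ => ⟨l.1 ^ 2, l.2.pow 2⟩) ?_ ?_ ?_ fun _ _ => rfl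
  · intro l hl
    rw [Finset.mem_filter, mem_monicsBelow, hp]
    exact ⟨by rw [l.2.natDegree_pow]; exact (hNM _).mpr (mem_monicsBelow.mp hl),
      ⟨l.1, sq l.1⟩⟩
  · intro l _ l' _ h
    refine Subtype.ext (eq_of_monic_of_associated l.2 l'.2 ?_)
    rcases sq_eq_sq_iff_eq_or_eq_neg.mp (congrArg Subtype.val h) with h | h
    · rw [h]
    · rw [h]
      exact (Associated.refl _).neg_left
  · rintro ⟨f, hf⟩ hfN
    rw [Finset.mem_filter, mem_monicsBelow, hp] at hfN
    obtain ⟨hfd, r, hr⟩ := hfN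
    change f = r * r at hr
    have hc : r.leadingCoeff * r.leadingCoeff = 1 := by
      rw [← leadingCoeff_mul, ← hr, hf.leadingCoeff]
    have hl : (C r.leadingCoeff * r).Monic := by
      rw [Monic, leadingCoeff_mul, leadingCoeff_C, hc]
    have hl2 : (C r.leadingCoeff * r) ^ 2 = f := by
      rw [mul_pow, ← C_pow, sq r.leadingCoeff, hc, C_1, one_mul, sq, hr]
    refine ⟨⟨_, hl⟩, mem_monicsBelow.mpr ((hNM _).mp ?_), Subtype.ext hl2⟩
    rw [← hl.natDegree_pow, hl2]
    exact hfd

end Enumeration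

section LocalFactors

theorem hasSum_two_mul_add_one_mul_pow {x : ℂ} (hx : ‖x‖ < 1) :
    HasSum (fun n : ℕ => (2 * n + 1) * x ^ n) ((1 + x) / (1 - x) ^ 2) := by
  have h1 : (1 - x) ≠ 0 := sub_ne_zero.mpr fun h => by simp [← h] at hx
  have h := ((hasSum_coe_mul_geometric_of_norm_lt_one hx).mul_left 2).add
    (hasSum_geometric_of_norm_lt_one hx)
  have h2 : (1 + x) / (1 - x) ^ 2 = 2 * (x / (1 - x) ^ 2) + (1 - x)⁻¹ := by
    field_simp
    ring
  rw [h2]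
  exact h.congr_fun fun n => by ring

theorem nm_add_one_ne_zero {q : ℕ} (f : Fqx q) : nm q f + 1 ≠ 0 := by
  rw [nm]
  exact_mod_cast (Nat.succ_ne_zero (q ^ f.natDegree))

theorem norm_nm_div_le_one {q : ℕ} (f : Fqx q) : ‖nm q f / (nm q f + 1)‖ ≤ 1 := by
  have h : nm q f / (nm q f + 1) =
      (((q : ℝ) ^ f.natDegree / ((q : ℝ) ^ f.natDegree + 1) : ℝ) : ℂ) := by
    rw [nm]; push_cast; rfl
  rw [h, Complex.norm_real, Real.norm_of_nonneg (by positivity)]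
  exact div_le_one_of_le₀ (by linarith) (by positivity)

variable {q : ℕ} [Fact q.Prime] {𝕜 : Type*} [NormedField 𝕜]

theorem summable_norm_pow_natDegree_irreducible {x : ℝ} (hx0 : 0 ≤ x) (hx : x < 1 / q) :
    Summable fun P : MIrr q => x ^ P.1.natDegree :=
  (summable_norm_pow_natDegree hx0 hx).comp_injective
    (i := fun P : MIrr q => (⟨P.1, P.2.1⟩ : {f : Fqx q // f.Monic}))
    fun _ _ h => Subtype.ext (congrArg (fun f : {f : Fqx q // f.Monic} => f.1) h)

theorem lt_one_of_lt_one_div {x : ℝ} (hx : x < 1 / q) : x < 1 := by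
  refine hx.trans_le ?_
  rw [div_le_one (Nat.cast_pos.mpr (NeZero.pos q))]
  exact Nat.one_le_cast.mpr (NeZero.pos q)

theorem summable_local_factors {f : MIrr q → ℕ → 𝕜} {K x : ℝ} (hK : 0 ≤ K) (hx0 : 0 ≤ x)
    (hx : x < 1 / q)
    (hf : ∀ P n, ‖f P (n + 1)‖ ≤ K * ((2 * n + 3) * x ^ ((n + 1) * P.1.natDegree))) :
    (∀ P, Summable fun n => ‖f P n‖) ∧ Summable fun P => ∑' n, ‖f P (n + 1)‖ := by
  have hx1 : x < 1 := lt_one_of_lt_one_div hx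
  have hS : Summable fun n : ℕ => (2 * n + 3 : ℝ) * x ^ n := by
    have h1 : Summable fun n : ℕ => (n : ℝ) ^ 1 * x ^ n :=
      summable_pow_mul_geometric_of_norm_lt_one 1 (by rwa [Real.norm_of_nonneg hx0])
    have h2 : Summable fun n : ℕ => x ^ n := summable_geometric_of_lt_one hx0 hx1
    refine ((h1.mul_left 2).add (h2.mul_left 3)).congr fun n => by ring
  have hle : ∀ P n, ‖f P (n + 1)‖ ≤ K * x ^ P.1.natDegree * ((2 * n + 3 : ℝ) * x ^ n) := by
    intro P n
    refine (hf P n).trans ?_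
    have hd : 1 ≤ P.1.natDegree := P.2.2.natDegree_pos
    have h3 : x ^ ((n + 1) * P.1.natDegree) ≤ x ^ P.1.natDegree * x ^ n := by
      rw [← pow_add]
      exact pow_le_pow_of_le_one hx0 hx1.le (by nlinarith)
    calc K * ((2 * n + 3) * x ^ ((n + 1) * P.1.natDegree))
        ≤ K * ((2 * n + 3) * (x ^ P.1.natDegree * x ^ n)) := by gcongr
      _ = _ := by ring
  have hs : ∀ P, Summable fun n => ‖f P (n + 1)‖ := fun P =>
    Summable.of_nonneg_of_le (fun _ => norm_nonneg _) (hle P) (hS.mul_left _)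
  refine ⟨fun P => (summable_nat_add_iff 1).mp (hs P), ?_⟩
  refine Summable.of_nonneg_of_le (fun P => tsum_nonneg fun _ => norm_nonneg _) (fun P => ?_)
    (((summable_norm_pow_natDegree_irreducible hx0 hx).mul_left K).mul_right
      (∑' n : ℕ, (2 * n + 3 : ℝ) * x ^ n))
  rw [← tsum_mul_left]
  exact (hs P).tsum_le_tsum (hle P) (hS.mul_left _)

/-- The local coefficients of the Dirichlet series of `d₂(l²) ∏_{P ∣ l} |P| / (|P| + 1)`. -/
noncomputable def mainLocal (q : ℕ) (P : MIrr q) (n : ℕ) : ℂ :=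
  if n = 0 then 1 else (2 * n + 1) * (nm q P.1 / (nm q P.1 + 1))

/-- The multiplicative function `d₂(l²) ∏_{P ∣ l} |P| / (|P| + 1)`. -/
noncomputable def mainWeight (q : ℕ) [Fact q.Prime] (l : {f : Fqx q // f.Monic}) : ℂ :=
  (exponentsEquiv.symm l).prod (mainLocal q)

theorem mainWeight_exponentsEquiv (b : MIrr q →₀ ℕ) :
    mainWeight q (exponentsEquiv b) = b.prod (mainLocal q) := by
  rw [mainWeight, Equiv.symm_apply_apply]

theorem summable_mainLocal {u : ℂ} (hu : ‖u‖ < 1 / q) :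
    (∀ P : MIrr q, Summable fun n => ‖mainLocal q P n * u ^ (n * P.1.natDegree)‖) ∧
      Summable fun P : MIrr q => ∑' n, ‖mainLocal q P (n + 1) * u ^ ((n + 1) * P.1.natDegree)‖ := by
  refine summable_local_factors (f := fun P n => mainLocal q P n * u ^ (n * P.1.natDegree))
    zero_le_one (norm_nonneg u) hu fun P n => ?_
  rw [mainLocal, if_neg n.succ_ne_zero, norm_mul, norm_mul, norm_pow, one_mul]
  gcongr
  have h3 : ‖(2 * ((n + 1 : ℕ) : ℂ) + 1)‖ = 2 * n + 3 := by
    have : (2 * ((n + 1 : ℕ) : ℂ) + 1) = ((2 * n + 3 : ℕ) : ℂ) := by push_cast; ring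
    rw [this, Complex.norm_natCast]; push_cast; ring
  rw [h3]
  exact mul_le_of_le_one_right (by positivity) (norm_nm_div_le_one _)

theorem mainWeight_mul_pow (b : MIrr q →₀ ℕ) (u : ℂ) :
    mainWeight q (exponentsEquiv b) * u ^ (exponentsEquiv b).1.natDegree =
      b.prod fun P n => mainLocal q P n * u ^ (n * P.1.natDegree) := by
  rw [mainWeight_exponentsEquiv, Finsupp.prod_mul]
  congr 1
  exact pow_natDegree_polyOfExponents u b

theorem summable_norm_mainWeight {u : ℂ} (hu : ‖u‖ < 1 / q) :
    Summable fun l : {f : Fqx q // f.Monic} => ‖mainWeight q l * u ^ l.1.natDegree‖ := by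
  rw [← exponentsEquiv.summable_iff]
  refine (summable_norm_finsupp_prod (fun P => ?_) (summable_mainLocal hu).1
    (summable_mainLocal hu).2).congr fun b => ?_
  · simp [mainLocal]
  · rw [Function.comp, mainWeight_mul_pow]

theorem norm_pow_natDegree_lt_one {u : ℂ} (hu : ‖u‖ < 1 / q) (P : MIrr q) :
    ‖u ^ P.1.natDegree‖ < 1 := by
  rw [norm_pow]
  exact pow_lt_one₀ (norm_nonneg u) (lt_one_of_lt_one_div hu) P.2.2.natDegree_pos.ne'

theorem hasSum_mainLocal {u : ℂ} (hu : ‖u‖ < 1 / q) (P : MIrr q) :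
    HasSum (fun n => mainLocal q P n * u ^ (n * P.1.natDegree))
      (1 + nm q P.1 / (nm q P.1 + 1) *
        ((1 + u ^ P.1.natDegree) / (1 - u ^ P.1.natDegree) ^ 2 - 1)) := by
  have h := hasSum_two_mul_add_one_mul_pow (norm_pow_natDegree_lt_one hu P)
  have h1 := ((h.sub (hasSum_ite_eq 0 (1 : ℂ))).mul_left (nm q P.1 / (nm q P.1 + 1))).add
    (hasSum_ite_eq 0 (1 : ℂ))
  rw [add_comm (nm q P.1 / _ * _)] at h1
  refine h1.congr_fun fun n => ?_
  rw [mainLocal, mul_comm n, pow_mul]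
  by_cases hn : n = 0
  · simp [hn]
  · simp [hn]; ring

theorem hasProd_zeta {u : ℂ} (hu : ‖u‖ < 1 / q) :
    HasProd (fun P : MIrr q => (1 - u ^ P.1.natDegree)⁻¹) (1 - q * u)⁻¹ := by
  have hs := summable_local_factors (q := q) (f := fun P n => u ^ (n * P.1.natDegree))
    zero_le_one (norm_nonneg u) hu fun P n => by
      rw [norm_pow, one_mul]
      refine le_mul_of_one_le_left (by positivity) ?_
      have : (0 : ℝ) ≤ n := n.cast_nonneg
      linarith
  have h := hasProd_tsum_finsupp_prod (fun P => by simp) hs.1 hs.2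
  have h2 : ∑' b : MIrr q →₀ ℕ, b.prod (fun P n => u ^ (n * P.1.natDegree)) =
      (1 - q * u)⁻¹ := by
    rw [← (hasSum_pow_natDegree hu).tsum_eq, ← exponentsEquiv.tsum_eq]
    exact tsum_congr fun b => (pow_natDegree_polyOfExponents u b).symm
  rw [h2] at h
  refine h.congr_fun fun P => ?_
  rw [← tsum_geometric_of_norm_lt_one (norm_pow_natDegree_lt_one hu P)]
  exact tsum_congr fun n => by rw [mul_comm, pow_mul]

theorem one_sub_natCast_mul_ne_zero {u : ℂ} (hu : ‖u‖ < 1 / q) : 1 - (q : ℂ) * u ≠ 0 := by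
  intro h
  have h1 : ‖(q : ℂ) * u‖ < 1 := by
    rw [norm_mul, Complex.norm_natCast]
    rwa [lt_div_iff₀' (Nat.cast_pos.mpr (NeZero.pos q))] at hu
  rw [← sub_eq_zero.mp h, norm_one] at h1
  exact lt_irrefl _ h1

theorem HasProd.inv_of_ne_zero {ι : Type*} {f : ι → ℂ} {a : ℂ} (h : HasProd f a) (ha : a ≠ 0) :
    HasProd (fun i => (f i)⁻¹) a⁻¹ := by
  have h' : Filter.Tendsto (fun s : Finset ι => ∏ i ∈ s, f i) Filter.atTop (nhds a) := h
  change Filter.Tendsto (fun s : Finset ι => ∏ i ∈ s, (f i)⁻¹) Filter.atTop (nhds a⁻¹)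
  simpa only [Finset.prod_inv_distrib] using h'.inv₀ ha

/-- The generating series of `mainWeight` is `(1 - q u²) B(u) / (1 - q u)³`. -/
theorem tsum_mainWeight {u : ℂ} (hu : ‖u‖ < 1 / q) :
    ∑' l : {f : Fqx q // f.Monic}, mainWeight q l * u ^ l.1.natDegree =
      (1 - q * u ^ 2) * Bfun q u / (1 - q * u) ^ 3 := by
  have hu2 : ‖u ^ 2‖ < 1 / q := by
    rw [norm_pow]
    refine lt_of_le_of_lt ?_ hu
    exact pow_le_of_le_one (norm_nonneg u) (lt_one_of_lt_one_div hu).le two_ne_zero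
  have h1 := one_sub_natCast_mul_ne_zero hu
  have h2 := one_sub_natCast_mul_ne_zero hu2
  have hA := hasProd_tsum_finsupp_prod
    (f := fun (P : MIrr q) n => mainLocal q P n * u ^ (n * P.1.natDegree))
    (fun P => by simp [mainLocal]) (summable_mainLocal hu).1 (summable_mainLocal hu).2
  have hsum : ∑' b : MIrr q →₀ ℕ, b.prod (fun P n => mainLocal q P n * u ^ (n * P.1.natDegree)) =
      ∑' l : {f : Fqx q // f.Monic}, mainWeight q l * u ^ l.1.natDegree := by
    rw [← exponentsEquiv.tsum_eq]
    exact tsum_congr fun b => (mainWeight_mul_pow b u).symm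
  rw [hsum] at hA
  have hZ := (hasProd_zeta hu).inv_of_ne_zero (inv_ne_zero h1)
  have hB := (hA.mul ((hZ.mul hZ).mul hZ)).mul (hasProd_zeta hu2)
  have hB' : Bfun q u = (∑' l : {f : Fqx q // f.Monic}, mainWeight q l * u ^ l.1.natDegree) *
      ((1 - q * u)⁻¹⁻¹ * (1 - q * u)⁻¹⁻¹ * (1 - q * u)⁻¹⁻¹) * (1 - q * u ^ 2)⁻¹ := by
    rw [← hB.tprod_eq, Bfun]
    refine tprod_congr fun P => ?_
    have hx := norm_pow_natDegree_lt_one hu P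
    rw [(hasSum_mainLocal hu P).tsum_eq, ← pow_mul, mul_comm 2, pow_mul]
    set x := u ^ P.1.natDegree
    have hx1 : 1 - x ≠ 0 := sub_ne_zero.mpr fun h => by simp [← h] at hx
    have hx2 : 1 + x ≠ 0 := fun h => by
      rw [← neg_eq_of_add_eq_zero_right h] at hx
      simp at hx
    have hN := nm_add_one_ne_zero P.1
    rw [show 1 - x ^ 2 = (1 - x) * (1 + x) by ring]
    field_simp
    ring
  rw [hB']
  field_simp

end LocalFactors

section Contour

theorem circleIntegral_zpow (r : ℝ) (hr : r ≠ 0) (n : ℤ) :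
    (∮ u in C(0, r), u ^ n) = if n = -1 then 2 * Real.pi * Complex.I else 0 := by
  split_ifs with h
  · rw [h]
    simpa [zpow_neg_one] using circleIntegral.integral_sub_center_inv 0 hr
  · simpa using circleIntegral.integral_sub_zpow_of_ne h 0 0 r

/-- Termwise integration over a circle. -/
theorem hasSum_circleIntegral_of_summable_norm {ι : Type*} [Countable ι] {r : ℝ} (hr : 0 ≤ r)
    {F : ι → ℂ → ℂ} {f : ℂ → ℂ} {bound : ι → ℝ} (hF : ∀ i, ContinuousOn (F i) (Metric.sphere 0 r))
    (hb : ∀ i, ∀ u ∈ Metric.sphere (0 : ℂ) r, ‖F i u‖ ≤ bound i) (hs : Summable bound)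
    (hf : ∀ u ∈ Metric.sphere (0 : ℂ) r, HasSum (fun i => F i u) (f u)) :
    HasSum (fun i => ∮ u in C(0, r), F i u) (∮ u in C(0, r), f u) := by
  have hmem : ∀ θ, circleMap 0 r θ ∈ Metric.sphere (0 : ℂ) r := circleMap_mem_sphere 0 hr
  refine intervalIntegral.hasSum_integral_of_dominated_convergence
    (fun i _ => r * bound i) (fun i => ?_) (fun i => ?_) ?_ ?_ ?_
  · refine Continuous.aestronglyMeasurable ?_
    simp only [deriv_circleMap]
    exact ((continuous_circleMap 0 r).mul continuous_const).smul
      ((hF i).comp_continuous (continuous_circleMap 0 r) hmem)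
  · refine Filter.Eventually.of_forall fun θ _ => ?_
    rw [norm_smul, deriv_circleMap, norm_mul, Complex.norm_I, mul_one, norm_circleMap_zero,
      abs_of_nonneg hr]
    exact mul_le_mul_of_nonneg_left (hb i _ (hmem θ)) hr
  · exact Filter.Eventually.of_forall fun θ _ => hs.mul_left r
  · exact intervalIntegrable_const
  · exact Filter.Eventually.of_forall fun θ _ => (hf _ (hmem θ)).const_smul _

variable {q : ℕ} [Fact q.Prime]

instance countable_monic : Countable {f : Fqx q // f.Monic} :=
  (monicEquiv q).symm.injective.countable

/-- Perron's formula for polynomials: a contour integral of the generating series picks out the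
partial sums of the coefficients. -/
theorem perron_formula {r : ℝ} (hr0 : 0 < r) (hr1 : r < 1 / q)
    {G : {f : Fqx q // f.Monic} → ℂ} (hG : Summable fun f => ‖G f‖ * r ^ f.1.natDegree) (k : ℤ) :
    (2 * (Real.pi : ℂ) * Complex.I)⁻¹ * ∮ u in C(0, r),
        (∑' f, G f * u ^ f.1.natDegree) / ((1 - q * u) * ((q : ℂ) * u) ^ k) / u =
      ∑ f ∈ monicsBelow q (k + 1).toNat, G f / (q : ℂ) ^ f.1.natDegree := by
  have hq : (0 : ℝ) < q := Nat.cast_pos.mpr (NeZero.pos q)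
  have hqC : (q : ℂ) ≠ 0 := NeZero.ne _
  have hqr : q * r < 1 := by rwa [lt_div_iff₀' hq] at hr1
  have hnorm : ∀ u ∈ Metric.sphere (0 : ℂ) r, ‖u‖ = r := fun u hu => by simpa using hu
  have hne : ∀ u ∈ Metric.sphere (0 : ℂ) r, u ≠ 0 := fun u hu h => by
    have := hnorm u hu
    rw [h, norm_zero] at this
    exact hr0.ne this
  have hgeo : Summable fun m : ℕ => (q * r) ^ m :=
    summable_geometric_of_lt_one (by positivity) hqr
  have hmain := hasSum_circleIntegral_of_summable_norm (ι := {f : Fqx q // f.Monic} × ℕ) hr0.le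
    (F := fun p u => (G p.1 * u ^ p.1.1.natDegree) * (q * u) ^ p.2 * (((q : ℂ) * u) ^ k)⁻¹ * u⁻¹)
    (f := fun u => (∑' f, G f * u ^ f.1.natDegree) / ((1 - q * u) * ((q : ℂ) * u) ^ k) / u)
    (bound := fun p => (‖G p.1‖ * r ^ p.1.1.natDegree) * (q * r) ^ p.2 * ((q * r) ^ k)⁻¹ * r⁻¹)
    (fun p => by
      refine ContinuousOn.mul (ContinuousOn.mul (by fun_prop) ?_) ?_
      · refine ContinuousOn.inv₀ (ContinuousOn.zpow₀ (by fun_prop) _ fun u hu => Or.inl ?_)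
          fun u hu => ?_
        · exact mul_ne_zero hqC (hne u hu)
        · exact zpow_ne_zero _ (mul_ne_zero hqC (hne u hu))
      · exact continuousOn_id.inv₀ hne)
    (fun p u hu => by
      simp only [norm_mul, norm_inv, norm_pow, norm_zpow, Complex.norm_natCast, hnorm u hu,
        le_refl])
    (by
      refine Summable.mul_right _ (Summable.mul_right _ ?_)
      exact hG.mul_of_nonneg hgeo (fun f => by positivity) fun m => by positivity)
    (fun u hu => by
      have h1 : Summable fun f : {f : Fqx q // f.Monic} => ‖G f * u ^ f.1.natDegree‖ := by
        simpa only [norm_mul, norm_pow, hnorm u hu] using hG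
      have h2 : ‖(q : ℂ) * u‖ < 1 := by
        rwa [norm_mul, Complex.norm_natCast, hnorm u hu]
      have h3 := (summable_mul_of_summable_norm h1
        (summable_norm_geometric_of_norm_lt_one h2)).hasSum
      rw [← tsum_mul_tsum_of_summable_norm h1 (summable_norm_geometric_of_norm_lt_one h2),
        tsum_geometric_of_norm_lt_one h2] at h3
      have h4 := (h3.mul_right (((q : ℂ) * u) ^ k)⁻¹).mul_right u⁻¹
      rw [div_eq_mul_inv _ u, div_eq_mul_inv, mul_inv, ← mul_assoc]
      exact h4)
  have hterm : ∀ p : {f : Fqx q // f.Monic} × ℕ, (∮ u in C(0, r),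
      (G p.1 * u ^ p.1.1.natDegree) * (q * u) ^ p.2 * (((q : ℂ) * u) ^ k)⁻¹ * u⁻¹) =
      if (p.1.1.natDegree : ℤ) + p.2 = k then
        2 * Real.pi * Complex.I * (G p.1 / (q : ℂ) ^ p.1.1.natDegree) else 0 := by
    rintro ⟨f, m⟩
    have : (∮ u in C(0, r), (G f * u ^ f.1.natDegree) * (q * u) ^ m * (((q : ℂ) * u) ^ k)⁻¹ * u⁻¹) =
        ∮ u in C(0, r), (G f * (q : ℂ) ^ ((m : ℤ) - k)) *
          u ^ ((f.1.natDegree : ℤ) + m - k - 1) := by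
      refine circleIntegral.integral_congr hr0.le fun u hu => ?_
      have hu0 := hne u hu
      rw [mul_zpow, zpow_sub₀ hu0, zpow_sub₀ hu0, zpow_add₀ hu0, zpow_sub₀ hqC]
      simp only [zpow_natCast, zpow_one]
      field_simp
      ring
    simp only
    rw [this, circleIntegral.integral_const_mul, circleIntegral_zpow r hr0.ne']
    by_cases h : (f.1.natDegree : ℤ) + m = k
    · rw [if_pos h, if_pos (by linarith), show (m : ℤ) - k = -(f.1.natDegree : ℤ) by linarith,
        zpow_neg, zpow_natCast]
      ring
    · rw [if_neg h, if_neg (fun h' => h (by linarith)), mul_zero]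
  simp only [hterm] at hmain
  have hfib := hmain.prod_fiberwise (g := fun f => if f ∈ monicsBelow q (k + 1).toNat then
    2 * Real.pi * Complex.I * (G f / (q : ℂ) ^ f.1.natDegree) else 0) (fun f => by
      simp only [mem_monicsBelow]
      by_cases h : f.1.natDegree < (k + 1).toNat
      · rw [if_pos h]
        refine (hasSum_ite_eq (k - f.1.natDegree).toNat _).congr_fun fun m => ?_
        refine if_congr ?_ rfl rfl
        omega
      · rw [if_neg h]
        refine hasSum_zero.congr_fun fun m => ?_
        rw [if_neg (by omega)])
  have hfin := hfib.unique (hasSum_sum_of_ne_finset_zero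
    (s := monicsBelow q (k + 1).toNat) fun f hf => if_neg hf)
  rw [hfin, Finset.sum_congr rfl fun f hf => if_pos hf, ← Finset.mul_sum, inv_mul_cancel_left₀]
  exact Complex.two_pi_I_ne_zero

end Contour

section SupportedSums

variable {q : ℕ} [Fact q.Prime]

theorem forall_dvd_polyOfExponents_iff (b c : MIrr q →₀ ℕ) :
    (∀ P : Fqx q, P.Monic → Irreducible P → P ∣ polyOfExponents b → P ∣ polyOfExponents c) ↔
      b.support ⊆ c.support := by
  constructor
  · intro h P hP
    rw [Finsupp.mem_support_iff, ← dvd_polyOfExponents_iff] at hP ⊢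
    exact h P.1 P.2.1 P.2.2 hP
  · intro h P hP hI hd
    have hd' := (dvd_polyOfExponents_iff ⟨P, hP, hI⟩ b).mp hd
    exact (dvd_polyOfExponents_iff ⟨P, hP, hI⟩ c).mpr
      (Finsupp.mem_support_iff.mp (h (Finsupp.mem_support_iff.mpr hd')))

theorem hasSum_pow_natDegree_of_forall_dvd {𝕜 : Type*} [NormedField 𝕜] [CompleteSpace 𝕜] {y : 𝕜}
    (hy : ‖y‖ < 1) (c : MIrr q →₀ ℕ) (p : Fqx q → Prop) [DecidablePred p]
    (hp : ∀ f, p f ↔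
      ∀ P : Fqx q, P.Monic → Irreducible P → P ∣ f → P ∣ polyOfExponents c) :
    HasSum (fun f : {f : Fqx q // f.Monic} => if p f.1 then y ^ f.1.natDegree else 0)
      (∏ P ∈ c.support, (1 - y ^ P.1.natDegree)⁻¹) := by
  have hy' : ∀ P : MIrr q, ‖y ^ P.1.natDegree‖ < 1 := fun P => by
    rw [norm_pow]
    exact pow_lt_one₀ (norm_nonneg y) hy P.2.2.natDegree_pos.ne'
  have hs : ∀ P : MIrr q, Summable fun n : ℕ => ‖y ^ (n * P.1.natDegree)‖ := fun P => by
    refine (summable_geometric_of_lt_one (norm_nonneg _) (hy' P)).congr fun n => ?_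
    rw [← norm_pow, ← pow_mul, mul_comm]
  have h0 : ∀ P : MIrr q, y ^ (0 * P.1.natDegree) = 1 := fun P => by rw [zero_mul, pow_zero]
  have h := (summable_norm_and_hasSum_prod_of_support_subset
    (f := fun (P : MIrr q) n => y ^ (n * P.1.natDegree)) h0 hs c.support).2
  have h2 : ∏ P ∈ c.support, ∑' n : ℕ, y ^ (n * P.1.natDegree) =
      ∏ P ∈ c.support, (1 - y ^ P.1.natDegree)⁻¹ :=
    Finset.prod_congr rfl fun P _ => by
      rw [← tsum_geometric_of_norm_lt_one (hy' P)]
      exact tsum_congr fun n => by rw [mul_comm, pow_mul]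
  rw [h2] at h
  rw [← exponentsEquiv.hasSum_iff]
  have h3 := (hasSum_subtype_iff_indicator
    (f := fun b : MIrr q →₀ ℕ => b.prod fun P n => y ^ (n * P.1.natDegree))
    (s := {b : MIrr q →₀ ℕ | b.support ⊆ c.support})).mp h
  refine h3.congr_fun fun b => ?_
  have hpb : p (exponentsEquiv b).1 ↔ b ∈ {b : MIrr q →₀ ℕ | b.support ⊆ c.support} :=
    (hp _).trans (forall_dvd_polyOfExponents_iff b c)
  simp only [Function.comp]
  by_cases hb : b ∈ {b : MIrr q →₀ ℕ | b.support ⊆ c.support}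
  · rw [if_pos (hpb.mpr hb), Set.indicator_of_mem hb]
    exact pow_natDegree_polyOfExponents y b
  · rw [if_neg (mt hpb.mp hb), Set.indicator_of_notMem hb]

/-- Rankin's trick for the tail of the sum over `C ∣ f^∞`. -/
theorem norm_sumCdiv_sub_le {y : ℝ} (hy0 : ((q : ℝ) ^ 2)⁻¹ ≤ y) (hy1 : y < 1) (g : ℕ)
    (c : MIrr q →₀ ℕ) :
    ‖sumCdiv q g (polyOfExponents c) -
        ∏ P ∈ c.support, (1 - ((q : ℂ) ^ 2)⁻¹ ^ P.1.natDegree)⁻¹‖ ≤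
      (((q : ℝ) ^ 2)⁻¹ / y) ^ g * ∏ P ∈ c.support, (1 - y ^ P.1.natDegree)⁻¹ := by
  classical
  have hq : (0 : ℝ) < q := Nat.cast_pos.mpr (NeZero.pos q)
  have hz : 0 < ((q : ℝ) ^ 2)⁻¹ := by positivity
  have hy : 0 < y := hz.trans_le hy0
  have hzn : ‖((q : ℂ) ^ 2)⁻¹‖ = ((q : ℝ) ^ 2)⁻¹ := by simp
  set p : Fqx q → Prop := fun f =>
    ∀ P : Fqx q, P.Monic → Irreducible P → P ∣ f → P ∣ polyOfExponents c with hp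
  have h1 := hasSum_pow_natDegree_of_forall_dvd (y := ((q : ℂ) ^ 2)⁻¹)
    (by rw [hzn]; exact hy0.trans_lt hy1) c p fun f => Iff.rfl
  have h2 := (hasSum_pow_natDegree_of_forall_dvd (y := y)
    (by rwa [Real.norm_of_nonneg hy.le]) c p fun f => Iff.rfl).mul_left
      ((((q : ℝ) ^ 2)⁻¹ / y) ^ g)
  have h3 : sumCdiv q g (polyOfExponents c) = ∑ f ∈ monicsBelow q g,
      if p f.1 then ((q : ℂ) ^ 2)⁻¹ ^ f.1.natDegree else 0 := by
    rw [sumCdiv, sumMle_eq_sum_monicsBelow, sub_add_cancel, Int.toNat_natCast]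
    refine Finset.sum_congr rfl fun f _ => ?_
    by_cases h : p f.1
    · rw [if_pos h, if_pos h, pow_mul, inv_pow]
    · rw [if_neg h, if_neg h]
  have h4 : HasSum (fun f => if f ∈ monicsBelow q g then
      (if p f.1 then ((q : ℂ) ^ 2)⁻¹ ^ f.1.natDegree else 0) else 0)
      (sumCdiv q g (polyOfExponents c)) := by
    have h := hasSum_sum_of_ne_finset_zero (L := SummationFilter.unconditional _)
      (s := monicsBelow q g)
      (f := fun f => if f ∈ monicsBelow q g then
        (if p f.1 then ((q : ℂ) ^ 2)⁻¹ ^ f.1.natDegree else 0) else 0) fun f hf => if_neg hf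
    rwa [Finset.sum_congr rfl fun f hf => if_pos hf, ← h3] at h
  refine (h4.sub h1).norm_le_of_bounded h2 fun f => ?_
  by_cases hf : p f.1
  · simp only [if_pos hf]
    by_cases hfg : f ∈ monicsBelow q g
    · rw [if_pos hfg, sub_self, norm_zero]
      positivity
    · rw [if_neg hfg, zero_sub, norm_neg, norm_pow, hzn]
      rw [mem_monicsBelow, not_lt] at hfg
      calc (((q : ℝ) ^ 2)⁻¹) ^ f.1.natDegree
          = (((q : ℝ) ^ 2)⁻¹ / y) ^ f.1.natDegree * y ^ f.1.natDegree := by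
            rw [← mul_pow, div_mul_cancel₀ _ hy.ne']
        _ ≤ _ := by
            gcongr ?_ * _
            exact pow_le_pow_of_le_one (by positivity) (div_le_one_of_le₀ hy0 hy.le) hfg
  · simp [if_neg hf]

end SupportedSums

section MainTerm

variable {q : ℕ} [Fact q.Prime]

/-- The multiplicative function `d₂(l²) ∏_{P ∣ l} (1 - y^{d(P)})⁻¹`. -/
noncomputable def rankinWeight (q : ℕ) [Fact q.Prime] (y : ℝ) (l : {f : Fqx q // f.Monic}) : ℝ :=
  (exponentsEquiv.symm l).prod fun P n =>
    if n = 0 then 1 else (2 * n + 1) * (1 - y ^ P.1.natDegree)⁻¹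

theorem rankinWeight_nonneg {y : ℝ} (hy0 : 0 ≤ y) (hy1 : y < 1) (l : {f : Fqx q // f.Monic}) :
    0 ≤ rankinWeight q y l := by
  refine Finset.prod_nonneg fun P _ => ?_
  have h := pow_le_one₀ (n := P.1.natDegree) hy0 hy1.le
  dsimp only
  split_ifs
  · exact zero_le_one
  · have := inv_nonneg.mpr (sub_nonneg.mpr h)
    positivity

theorem summable_rankinWeight {x y : ℝ} (hx0 : 0 ≤ x) (hx : x < 1 / q) (hy0 : 0 ≤ y)
    (hy1 : y < 1) :
    Summable fun l : {f : Fqx q // f.Monic} => rankinWeight q y l * x ^ l.1.natDegree := by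
  have hs := summable_local_factors (q := q) (K := (1 - y)⁻¹) (x := x)
    (f := fun P n => (if n = 0 then 1 else (2 * n + 1) * (1 - y ^ P.1.natDegree)⁻¹) *
      x ^ (n * P.1.natDegree)) (inv_nonneg.mpr (by linarith)) hx0 hx fun P n => by
    have hd : y ^ P.1.natDegree ≤ y := pow_le_of_le_one hy0 hy1.le P.2.2.natDegree_pos.ne'
    have h1 : (0 : ℝ) < 1 - y := by linarith
    have h2 : (0 : ℝ) < 1 - y ^ P.1.natDegree := by linarith
    rw [if_neg n.succ_ne_zero, Real.norm_of_nonneg (by positivity)]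
    calc (2 * ((n + 1 : ℕ) : ℝ) + 1) * (1 - y ^ P.1.natDegree)⁻¹ * x ^ ((n + 1) * P.1.natDegree)
        = (1 - y ^ P.1.natDegree)⁻¹ * ((2 * n + 3) * x ^ ((n + 1) * P.1.natDegree)) := by
          push_cast; ring
      _ ≤ _ := by gcongr
  have h := Summable.of_norm (summable_norm_finsupp_prod (f := fun (P : MIrr q) n =>
    (if n = 0 then 1 else (2 * n + 1) * (1 - y ^ P.1.natDegree)⁻¹) * x ^ (n * P.1.natDegree))
    (fun P => by simp) hs.1 hs.2)
  rw [← exponentsEquiv.summable_iff]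
  refine h.congr fun b => ?_
  rw [Function.comp, rankinWeight, Equiv.symm_apply_apply, Finsupp.prod_mul]
  congr 1
  exact (pow_natDegree_polyOfExponents x b).symm

/-- The summand of `Mterm q 2` at a square, up to the sum over `C`. -/
theorem dk_mul_polyPhi_div_sqrt (b : MIrr q →₀ ℕ) :
    (dk q 2 (polyOfExponents b ^ 2) : ℂ) * polyPhi q (polyOfExponents b ^ 2) /
        (Real.sqrt ((q : ℝ) ^ (3 * (polyOfExponents b ^ 2).natDegree)) : ℂ) =
      (∏ P ∈ b.support, (2 * b P + 1 : ℂ)) * (∏ P ∈ b.support, (1 - 1 / nm q P.1)) /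
        (q : ℂ) ^ (polyOfExponents b).natDegree := by
  have hq : (0 : ℝ) < q := Nat.cast_pos.mpr (NeZero.pos q)
  have hqC : (q : ℂ) ≠ 0 := Nat.cast_ne_zero.mpr (NeZero.ne q)
  have hdeg : (polyOfExponents b ^ 2).natDegree = 2 * (polyOfExponents b).natDegree :=
    (monic_polyOfExponents b).natDegree_pow 2
  have hsqrt : Real.sqrt ((q : ℝ) ^ (3 * (2 * (polyOfExponents b).natDegree))) =
      (q : ℝ) ^ (3 * (polyOfExponents b).natDegree) := by
    rw [show 3 * (2 * (polyOfExponents b).natDegree) = 3 * (polyOfExponents b).natDegree * 2 by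
      ring,
      pow_mul _ _ 2, Real.sqrt_sq (by positivity)]
  have hsupp : (b + b).support = b.support := by
    ext P; simp
  have hsq : polyOfExponents b ^ 2 = polyOfExponents (b + b) := by
    rw [polyOfExponents_add, sq]
  have hd : (dk q 2 (polyOfExponents b ^ 2) : ℂ) = ∏ P ∈ b.support, (2 * b P + 1 : ℂ) := by
    rw [hsq, dk_two_polyOfExponents, Finsupp.prod, hsupp]
    push_cast
    exact Finset.prod_congr rfl fun P _ => by simp [two_mul]
  have hphi : (polyPhi q (polyOfExponents b ^ 2) : ℂ) =
      (q : ℂ) ^ (2 * (polyOfExponents b).natDegree) * ∏ P ∈ b.support, (1 - 1 / nm q P.1) := by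
    rw [hsq, polyPhi_polyOfExponents, Finsupp.prod, hsupp, ← hsq, nm, hdeg]
    congr 1
    exact Finset.prod_congr rfl fun P hP => if_neg (by simpa using hP)
  rw [hd, hphi, hdeg, hsqrt]
  push_cast
  field_simp
  ring

theorem norm_term_sub_le {y : ℝ} (hy0 : ((q : ℝ) ^ 2)⁻¹ ≤ y) (hy1 : y < 1) (g : ℕ)
    (l : {f : Fqx q // f.Monic}) :
    ‖(dk q 2 (l.1 ^ 2) : ℂ) * polyPhi q (l.1 ^ 2) /
        (Real.sqrt ((q : ℝ) ^ (3 * (l.1 ^ 2).natDegree)) : ℂ) * sumCdiv q g (l.1 ^ 2) -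
          mainWeight q l / (q : ℂ) ^ l.1.natDegree‖ ≤
      (((q : ℝ) ^ 2)⁻¹ / y) ^ g * (rankinWeight q y l / (q : ℝ) ^ l.1.natDegree) := by
  obtain ⟨b, rfl⟩ := exponentsEquiv.surjective l
  have hl : (exponentsEquiv b).1 = polyOfExponents b := rfl
  have hq : (1 : ℝ) < q := Nat.one_lt_cast.mpr (Fact.out : q.Prime).one_lt
  have hqC : (q : ℂ) ≠ 0 := Nat.cast_ne_zero.mpr (NeZero.ne q)
  have hN : ∀ P : MIrr q, 1 < (q : ℝ) ^ P.1.natDegree := fun P =>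
    one_lt_pow₀ hq P.2.2.natDegree_pos.ne'
  have hsupp : (b + b).support = b.support := by
    ext P; simp
  have hsq : polyOfExponents b ^ 2 = polyOfExponents (b + b) := by
    rw [polyOfExponents_add, sq]
  have hC := norm_sumCdiv_sub_le hy0 hy1 g (b + b)
  rw [hsupp, ← hsq] at hC
  have hmain : mainWeight q (exponentsEquiv b) =
      (∏ P ∈ b.support, (2 * b P + 1 : ℂ)) * (∏ P ∈ b.support, (1 - 1 / nm q P.1)) *
        ∏ P ∈ b.support, (1 - ((q : ℂ) ^ 2)⁻¹ ^ P.1.natDegree)⁻¹ := by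
    rw [mainWeight_exponentsEquiv, Finsupp.prod, ← Finset.prod_mul_distrib,
      ← Finset.prod_mul_distrib]
    refine Finset.prod_congr rfl fun P hP => ?_
    rw [mainLocal, if_neg (by simpa using hP), mul_assoc]
    congr 1
    have h0 : nm q P.1 ≠ 0 := pow_ne_zero _ hqC
    have h1 : nm q P.1 - 1 ≠ 0 := sub_ne_zero.mpr fun h => (hN P).ne' (by
      rw [nm] at h; exact_mod_cast h)
    have h2 := nm_add_one_ne_zero P.1
    have h3 : ((q : ℂ) ^ 2)⁻¹ ^ P.1.natDegree = (nm q P.1 ^ 2)⁻¹ := by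
      rw [nm, inv_pow, ← pow_mul, ← pow_mul, mul_comm]
    have h4 : 1 - (nm q P.1 ^ 2)⁻¹ = (nm q P.1 - 1) * (nm q P.1 + 1) / nm q P.1 ^ 2 := by
      field_simp
      ring
    rw [h3, h4]
    field_simp
  have hrankin : rankinWeight q y (exponentsEquiv b) =
      (∏ P ∈ b.support, (2 * b P + 1 : ℝ)) * ∏ P ∈ b.support, (1 - y ^ P.1.natDegree)⁻¹ := by
    rw [rankinWeight, Equiv.symm_apply_apply, Finsupp.prod, ← Finset.prod_mul_distrib]
    exact Finset.prod_congr rfl fun P hP => if_neg (by simpa using hP)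
  have hD : ‖∏ P ∈ b.support, (2 * b P + 1 : ℂ)‖ = ∏ P ∈ b.support, (2 * b P + 1 : ℝ) := by
    rw [norm_prod]
    refine Finset.prod_congr rfl fun P _ => ?_
    exact_mod_cast Complex.norm_natCast (2 * b P + 1)
  have hPhi : ‖∏ P ∈ b.support, (1 - 1 / nm q P.1)‖ ≤ 1 := by
    rw [norm_prod]
    refine Finset.prod_le_one (fun _ _ => norm_nonneg _) fun P _ => ?_
    have h : (1 - 1 / nm q P.1) = ((1 - 1 / (q : ℝ) ^ P.1.natDegree : ℝ) : ℂ) := by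
      rw [nm]; push_cast; rfl
    have h1 : 1 / (q : ℝ) ^ P.1.natDegree ≤ 1 := by
      rw [div_le_one (by linarith [hN P])]
      exact (hN P).le
    have h2 : 0 < 1 / (q : ℝ) ^ P.1.natDegree := by positivity
    rw [h, Complex.norm_real, Real.norm_of_nonneg (by linarith)]
    linarith
  rw [hmain, hrankin, hl, dk_mul_polyPhi_div_sqrt, div_mul_eq_mul_div, ← sub_div, ← mul_sub,
    norm_div, norm_mul, norm_mul, hD, norm_pow, Complex.norm_natCast, ← mul_div_assoc]
  refine div_le_div_of_nonneg_right ?_ (by positivity)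
  calc (∏ P ∈ b.support, (2 * b P + 1 : ℝ)) * ‖∏ P ∈ b.support, (1 - 1 / nm q P.1)‖ *
        ‖sumCdiv q g (polyOfExponents b ^ 2) -
          ∏ P ∈ b.support, (1 - ((q : ℂ) ^ 2)⁻¹ ^ P.1.natDegree)⁻¹‖
      ≤ (∏ P ∈ b.support, (2 * b P + 1 : ℝ)) * 1 * ((((q : ℝ) ^ 2)⁻¹ / y) ^ g *
          ∏ P ∈ b.support, (1 - y ^ P.1.natDegree)⁻¹) := by gcongr
    _ = _ := by ring

theorem norm_Mterm_sub_le {y : ℝ} (hy0 : ((q : ℝ) ^ 2)⁻¹ ≤ y) (hy1 : y < 1) {N : ℤ} {M g : ℕ}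
    (hNM : ∀ d : ℕ, 2 * d < (N + 1).toNat ↔ d < M) (hM : M ≤ g + 1) :
    ‖Mterm q 2 N g - (q : ℂ) ^ (2 * g + 1) * (1 - 1 / q) *
        ∑ l ∈ monicsBelow q M, mainWeight q l / (q : ℂ) ^ l.1.natDegree‖ ≤
      q * (∑' l, rankinWeight q y l * (y / q) ^ l.1.natDegree) * (y⁻¹ ^ 2) ^ g := by
  have hq : (1 : ℝ) < q := Nat.one_lt_cast.mpr (Fact.out : q.Prime).one_lt
  have hy : 0 < y := lt_of_lt_of_le (by positivity) hy0
  have hsum := summable_rankinWeight (q := q) (x := y / q) (y := y) (by positivity)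
    (by gcongr) hy.le hy1
  classical
  rw [Mterm, sumMle_eq_sum_monicsBelow, sum_monicsBelow_ite_isSquare hNM
    (fun f => (dk q 2 f : ℂ) * polyPhi q f / (Real.sqrt ((q : ℝ) ^ (3 * f.natDegree)) : ℂ) *
      sumCdiv q g f) IsSquare fun _ => Iff.rfl, ← mul_sub, ← Finset.sum_sub_distrib,
    norm_mul]
  have h1 : ‖(q : ℂ) ^ (2 * g + 1) * (1 - 1 / q)‖ ≤ (q : ℝ) ^ (2 * g + 1) := by
    have h : (1 - 1 / (q : ℂ)) = ((1 - 1 / (q : ℝ) : ℝ) : ℂ) := by push_cast; rfl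
    have h1 : 1 / (q : ℝ) ≤ 1 := by
      rw [div_le_one (by linarith)]
      exact hq.le
    have h2 : 0 < 1 / (q : ℝ) := by positivity
    rw [norm_mul, norm_pow, Complex.norm_natCast, h, Complex.norm_real,
      Real.norm_of_nonneg (by linarith)]
    exact mul_le_of_le_one_right (by positivity) (by linarith)
  have h2 : ∀ l ∈ monicsBelow q M, (((q : ℝ) ^ 2)⁻¹ / y) ^ g *
      (rankinWeight q y l / (q : ℝ) ^ l.1.natDegree) ≤
      (((q : ℝ) ^ 2)⁻¹ * y⁻¹ ^ 2) ^ g * (rankinWeight q y l * (y / q) ^ l.1.natDegree) := by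
    intro l hl
    have hlg : l.1.natDegree ≤ g := by
      rw [mem_monicsBelow] at hl
      omega
    have hr := rankinWeight_nonneg hy.le hy1 l
    have h3 : y⁻¹ ^ l.1.natDegree ≤ y⁻¹ ^ g := pow_le_pow_right₀ (one_le_inv₀ hy |>.mpr hy1.le) hlg
    calc (((q : ℝ) ^ 2)⁻¹ / y) ^ g * (rankinWeight q y l / (q : ℝ) ^ l.1.natDegree)
        = (((q : ℝ) ^ 2)⁻¹ / y) ^ g * (rankinWeight q y l * (y / q) ^ l.1.natDegree *
            y⁻¹ ^ l.1.natDegree) := by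
          rw [div_pow y, inv_pow]
          field_simp
      _ ≤ (((q : ℝ) ^ 2)⁻¹ / y) ^ g * (rankinWeight q y l * (y / q) ^ l.1.natDegree *
            y⁻¹ ^ g) := by gcongr
      _ = _ := by
          rw [div_eq_mul_inv _ y, mul_pow, mul_pow, sq y⁻¹, mul_pow]
          ring
  calc _ ≤ (q : ℝ) ^ (2 * g + 1) * ((((q : ℝ) ^ 2)⁻¹ * y⁻¹ ^ 2) ^ g *
        ∑' l, rankinWeight q y l * (y / q) ^ l.1.natDegree) := by
        gcongr
        refine (norm_sum_le _ _).trans ?_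
        refine (Finset.sum_le_sum fun l hl =>
          (norm_term_sub_le hy0 hy1 g l).trans (h2 l hl)).trans ?_
        rw [← Finset.mul_sum]
        gcongr
        exact hsum.sum_le_tsum _ fun l _ =>
          mul_nonneg (rankinWeight_nonneg hy.le hy1 l) (by positivity)
    _ = _ := by
        rw [mul_pow, pow_succ (q : ℝ), pow_mul (q : ℝ), inv_pow]
        field_simp

theorem contourIntegral_eq_sum_mainWeight {r : ℝ} (hr0 : 0 < r) (hr1 : r < 1 / q) (k : ℤ) :
    (2 * (Real.pi : ℂ) * Complex.I)⁻¹ * ∮ u in C(0, r), (1 - q * u ^ 2) * Bfun q u /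
        ((1 - q * u) ^ 4 * ((q : ℂ) * u) ^ k) / u =
      ∑ l ∈ monicsBelow q (k + 1).toNat, mainWeight q l / (q : ℂ) ^ l.1.natDegree := by
  have hG : Summable fun l : {f : Fqx q // f.Monic} => ‖mainWeight q l‖ * r ^ l.1.natDegree := by
    have hr : ‖(r : ℂ)‖ = r := by rw [Complex.norm_real, Real.norm_of_nonneg hr0.le]
    refine (summable_norm_mainWeight (u := (r : ℂ)) (by rwa [hr])).congr fun l => ?_
    rw [norm_mul, norm_pow, hr]
  rw [← perron_formula hr0 hr1 hG k]
  congr 1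
  refine circleIntegral.integral_congr hr0.le fun u hu => ?_
  have hu' : ‖u‖ < 1 / q := by rwa [mem_sphere_zero_iff_norm.mp hu]
  change _ = (∑' l, mainWeight q l * u ^ l.1.natDegree) / ((1 - q * u) * ((q : ℂ) * u) ^ k) / u
  rw [tsum_mainWeight hu', div_div _ _ ((1 - q * u) * _), ← mul_assoc, ← pow_succ]

end MainTerm

/-- the main terms `M_{2g}`, `M_{2g-1}` as contour integrals:
for every `ε > 0` and `0 < r₁ < 1/q`,
`M_{2g} = (q^{2g+1}/ζ(2)) (1/2πi) ∮_{|u|=r₁} (1-qu²)B(u)/((1-qu)⁴(qu)^g) du/u + O_ε(q^{gε})`,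
and similarly for `M_{2g-1}` with `(qu)^g` replaced by `(qu)^{g-1}`. -/
theorem main_term_contour_integral (q : ℕ) [Fact q.Prime] (hq4 : q % 4 = 1)
    (ε : ℝ) (hε : 0 < ε) (r₁ : ℝ) (hr0 : 0 < r₁) (hr1 : r₁ < 1 / q) :
    ∃ K : ℝ, 0 < K ∧ ∀ g : ℕ,
      ‖Mterm q 2 (2 * (g : ℤ)) g -
          (q : ℂ) ^ (2 * g + 1) * (1 - 1 / q) * (2 * (Real.pi : ℂ) * Complex.I)⁻¹ *
            ∮ u in C(0, r₁),
              (1 - q * u ^ 2) * Bfun q u /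
                ((1 - q * u) ^ 4 * ((q : ℂ) * u) ^ (g : ℤ)) / u‖ ≤
        K * (q : ℝ) ^ ((g : ℝ) * ε) ∧
      ‖Mterm q 2 (2 * (g : ℤ) - 1) g -
          (q : ℂ) ^ (2 * g + 1) * (1 - 1 / q) * (2 * (Real.pi : ℂ) * Complex.I)⁻¹ *
            ∮ u in C(0, r₁),
              (1 - q * u ^ 2) * Bfun q u /
                ((1 - q * u) ^ 4 * ((q : ℂ) * u) ^ ((g : ℤ) - 1)) / u‖ ≤
        K * (q : ℝ) ^ ((g : ℝ) * ε) := by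
  have hq : (1 : ℝ) < q := Nat.one_lt_cast.mpr (Fact.out : q.Prime).one_lt
  have hq0 : (0 : ℝ) < q := by linarith
  set y : ℝ := (q : ℝ) ^ (-min 2 (ε / 2)) with hy
  have hy0 : ((q : ℝ) ^ 2)⁻¹ ≤ y := by
    rw [← Real.rpow_two, ← Real.rpow_neg hq0.le]
    exact Real.rpow_le_rpow_of_exponent_le hq.le (neg_le_neg (min_le_left _ _))
  have hy1 : y < 1 := Real.rpow_lt_one_of_one_lt_of_neg hq
    (neg_neg_of_pos (lt_min two_pos (half_pos hε)))
  have hypos : 0 < y := Real.rpow_pos_of_pos hq0 _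
  have hyε : ∀ g : ℕ, (y⁻¹ ^ 2) ^ g ≤ (q : ℝ) ^ ((g : ℝ) * ε) := fun g => by
    rw [mul_comm (g : ℝ), Real.rpow_mul hq0.le, Real.rpow_natCast]
    gcongr
    rw [hy, ← Real.rpow_neg hq0.le, neg_neg, ← Real.rpow_two, ← Real.rpow_mul hq0.le]
    refine Real.rpow_le_rpow_of_exponent_le hq.le ?_
    linarith [min_le_right 2 (ε / 2)]
  set K₀ := ∑' l : {f : Fqx q // f.Monic}, rankinWeight q y l * (y / q) ^ l.1.natDegree
  have hK₀ : 0 ≤ K₀ := tsum_nonneg fun l =>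
    mul_nonneg (rankinWeight_nonneg hypos.le hy1 l) (by positivity)
  have hbound : ∀ g : ℕ, q * K₀ * (y⁻¹ ^ 2) ^ g ≤ (q * K₀ + 1) * (q : ℝ) ^ ((g : ℝ) * ε) :=
    fun g => mul_le_mul (by linarith) (hyε g) (by positivity) (by positivity)
  refine ⟨q * K₀ + 1, by positivity, fun g => ⟨?_, ?_⟩⟩
  · rw [mul_assoc ((q : ℂ) ^ (2 * g + 1) * (1 - 1 / q)),
      contourIntegral_eq_sum_mainWeight hr0 hr1]
    exact (norm_Mterm_sub_le hy0 hy1 (fun d => by omega) (by omega)).trans (hbound g)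
  · rw [mul_assoc ((q : ℂ) ^ (2 * g + 1) * (1 - 1 / q)),
      contourIntegral_eq_sum_mainWeight hr0 hr1]
    exact (norm_Mterm_sub_le hy0 hy1 (fun d => by omega) (by omega)).trans (hbound g)
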